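/- arXiv:1701.02219 — 4 statements merged into one kernel-verified Lean document; each statement's English description precedes it below -/
import Mathlib

section
/- Let k, ℓ, ℓ' be natural numbers with ℓ < k and ℓ' < k. Then the function x ↦ Q^k_ℓ(i·x)·Q^k_{ℓ'}(i·x) is Lebesgue integrable on ℝ and ∫_{-∞}^{+∞} Q^k_ℓ(i·x)·Q^k_{ℓ'}(i·x) dx = (2ℓ)!·π·∏_{i=ℓ+2}^{k} (ℓ+i)·(ℓ−i+1) if ℓ = ℓ', and = 0 if ℓ ≠ ℓ' (the product over i from ℓ+2 to k is the empty product, equal to 1, when k = ℓ+1). -/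
open MeasureTheory Filter Finset

/-- Legendre polynomial of the first kind via the Rodrigues formula,
evaluated at a complex argument. -/
noncomputable def legP (l : ℕ) (z : ℂ) : ℂ :=
  (1 / (2 ^ l * (l.factorial : ℂ))) * iteratedDeriv l (fun w : ℂ => (w ^ 2 - 1) ^ l) z

/-- Legendre function of the second kind `Q_ℓ` (Ferrers branch), for complex argument. -/
noncomputable def legQ (l : ℕ) (z : ℂ) : ℂ :=
  (1 / 2) * legP l z * Complex.log ((1 + z) / (1 - z)) -
    ∑ j ∈ Finset.Icc 1 l, legP (j - 1) z * legP (l - j) z / (j : ℂ)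

/-- The associated Legendre function of the second kind on the imaginary axis:
`Q^k_ℓ(i·x) = (−1)^k (1+x²)^{k/2} i^{−k} (d/dx)^k [Q_ℓ(i·x)]`. -/
noncomputable def Qi (k l : ℕ) (x : ℝ) : ℂ :=
  (-1) ^ k * (((1 + x ^ 2) ^ ((k : ℝ) / 2) : ℝ) : ℂ) * Complex.I ^ (-(k : ℤ)) *
    iteratedDeriv k (fun t : ℝ => legQ l (Complex.I * t)) x

section

open Polynomial

/-- The `n`-th derivative of `(1 + X²)^l`. -/
noncomputable def legU (l n : ℕ) : ℂ[X] := derivative^[n] ((1 + X ^ 2) ^ l)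

/-- The numerators in `D^m [p · arctan] = D^m p · arctan + legR l m / (1 + x²)^m`,
where `p = legU l l`. -/
noncomputable def legR (l : ℕ) : ℕ → ℂ[X]
  | 0 => 0
  | m + 1 => (1 + X ^ 2) ^ m * legU l (l + m) + (1 + X ^ 2) * derivative (legR l m)
      - 2 * (m : ℂ[X]) * X * legR l m

theorem derivative_legU (l n : ℕ) : derivative (legU l n) = legU l (n + 1) := by
  simp only [legU, Function.iterate_succ_apply']

theorem one_add_X_sq_mul_legU_one (l : ℕ) :
    (1 + X ^ 2) * legU l 1 = 2 * (l : ℂ[X]) * X * legU l 0 := by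
  cases l with
  | zero => simp [legU]
  | succ l =>
    simp [legU, derivative_pow, map_ofNat]
    ring

theorem legU_ode (l n : ℕ) :
    (1 + X ^ 2) * legU l (n + 2) + 2 * ((n : ℂ[X]) + 1 - (l : ℂ[X])) * X * legU l (n + 1)
      + ((n : ℂ[X]) + 1) * ((n : ℂ[X]) - 2 * (l : ℂ[X])) * legU l n = 0 := by
  induction n with
  | zero =>
    have h := congrArg derivative (one_add_X_sq_mul_legU_one l)
    simp [derivative_legU] at h
    push_cast
    linear_combination h
  | succ n ih =>
    have h := congrArg derivative ih
    simp [derivative_legU] at h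
    push_cast
    linear_combination h

theorem legR_ode (l m : ℕ) :
    legR l (m + 2) + 2 * ((m : ℂ[X]) + 1) * X * legR l (m + 1)
      + ((m : ℂ[X]) - (l : ℂ[X])) * ((m : ℂ[X]) + (l : ℂ[X]) + 1) * (1 + X ^ 2) * legR l m
      = 2 * (1 + X ^ 2) ^ (m + 1) * legU l (l + m + 1) := by
  induction m with
  | zero =>
    have h1 : legR l 1 = legU l l := by simp [legR]
    have h2 : legR l 2 = (1 + X ^ 2) ^ 1 * legU l (l + 1) + (1 + X ^ 2) * derivative (legR l 1)
      - 2 * ((1 : ℕ) : ℂ[X]) * X * legR l 1 := rfl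
    rw [h1, derivative_legU] at h2
    have h0 : legR l 0 = 0 := rfl
    simp only [zero_add, add_zero, h0, h1, h2]
    push_cast
    ring
  | succ m ih =>
    have h := congrArg derivative ih
    have h3 : legR l (m + 3) = (1 + X ^ 2) ^ (m + 2) * legU l (l + (m + 2))
      + (1 + X ^ 2) * derivative (legR l (m + 2))
      - 2 * ((m + 2 : ℕ) : ℂ[X]) * X * legR l (m + 2) := rfl
    have h2 : legR l (m + 2) = (1 + X ^ 2) ^ (m + 1) * legU l (l + (m + 1))
      + (1 + X ^ 2) * derivative (legR l (m + 1))
      - 2 * ((m + 1 : ℕ) : ℂ[X]) * X * legR l (m + 1) := rfl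
    have h1 : legR l (m + 1) = (1 + X ^ 2) ^ m * legU l (l + m)
      + (1 + X ^ 2) * derivative (legR l m)
      - 2 * (m : ℂ[X]) * X * legR l m := rfl
    have hU := legU_ode l (l + m)
    simp [derivative_legU, derivative_pow, map_ofNat] at h
    simp only [← add_assoc] at h3 h2 h1 hU ⊢
    push_cast at h3 h2 h1 hU ⊢
    linear_combination (1 + X ^ 2) * h - 2 * ((m : ℂ[X]) + 1) * X * ih + h3
      + 2 * ((m : ℂ[X]) + 1) * X * h2
      + ((m : ℂ[X]) - (l : ℂ[X])) * ((m : ℂ[X]) + (l : ℂ[X]) + 1) * (1 + X ^ 2) * h1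
      + (1 + X ^ 2) ^ (m + 1) * hU

theorem natDegree_one_add_X_sq_pow_le (l : ℕ) : ((1 + X ^ 2 : ℂ[X]) ^ l).natDegree ≤ 2 * l := by
  have : (1 + X ^ 2 : ℂ[X]).natDegree ≤ 2 := by compute_degree
  exact natDegree_pow_le_of_le l this |>.trans (by omega)

theorem legU_eq_zero {l n : ℕ} (h : 2 * l < n) : legU l n = 0 :=
  iterate_derivative_eq_zero ((natDegree_one_add_X_sq_pow_le l).trans_lt h)

theorem legR_succ_of_lt {l m : ℕ} (h : l < m) :
    legR l (m + 1) = (1 + X ^ 2) * derivative (legR l m) - 2 * (m : ℂ[X]) * X * legR l m := by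
  rw [legR, legU_eq_zero (by omega)]
  ring

theorem legR_ode_of_le {l m : ℕ} (h : l ≤ m) :
    legR l (m + 2) + 2 * ((m : ℂ[X]) + 1) * X * legR l (m + 1)
      + ((m : ℂ[X]) - (l : ℂ[X])) * ((m : ℂ[X]) + (l : ℂ[X]) + 1) * (1 + X ^ 2) * legR l m = 0 := by
  rw [legR_ode, legU_eq_zero (by omega), mul_zero]

theorem one_add_X_sq_ne_zero : (1 + X ^ 2 : ℂ[X]) ≠ 0 := by
  intro h
  simpa using congrArg (eval 0) h

theorem derivative_legR_succ_self (l : ℕ) : derivative (legR l (l + 1)) = 0 := by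
  have h := legR_ode_of_le (le_refl l)
  rw [legR_succ_of_lt (Nat.lt_succ_self l)] at h
  push_cast at h
  refine (mul_eq_zero.1 (?_ : (1 + X ^ 2) * derivative (legR l (l + 1)) = 0)).resolve_left
    one_add_X_sq_ne_zero
  linear_combination h

theorem natDegree_legR_le (l m : ℕ) : (legR l (l + 1 + m)).natDegree ≤ m := by
  induction m with
  | zero => exact (derivative_eq_zero.1 (derivative_legR_succ_self l)).le
  | succ m ih =>
    rw [← add_assoc, legR_succ_of_lt (by omega)]
    refine (natDegree_sub_le _ _).trans (max_le ?_ ?_)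
    · cases m with
      | zero => simp [derivative_legR_succ_self]
      | succ m =>
        refine natDegree_mul_le.trans ?_
        have h1 : (1 + X ^ 2 : ℂ[X]).natDegree ≤ 2 := by compute_degree
        have h2 := natDegree_derivative_le (legR l (l + 1 + (m + 1)))
        omega
    · refine natDegree_mul_le.trans ?_
      have h1 : (2 * ((l + 1 + m : ℕ) : ℂ[X]) * X).natDegree ≤ 1 := by compute_degree
      omega

theorem eval_I_legU (l : ℕ) : (legU l l).eval Complex.I = l.factorial * (2 * Complex.I) ^ l := by
  have h : (1 + X ^ 2 : ℂ[X]) = (X - C Complex.I) * (X - C (-Complex.I)) := by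
    have : (C Complex.I * C Complex.I : ℂ[X]) = -1 := by rw [← C_mul]; simp
    simp only [C_neg]
    linear_combination this
  rw [legU, h, mul_pow, iterate_derivative_mul, eval_finsetSum,
    Finset.sum_eq_single_of_mem 0 (by simp)]
  · simp [iterate_derivative_X_sub_pow_self]
    left; ring
  · intro b hb hb0
    have : l - (l - b) ≠ 0 := by simp at hb; omega
    simp [iterate_derivative_X_sub_pow, this]

theorem eval_I_legR (l m : ℕ) : (legR l (m + 1)).eval Complex.I =
    (-2 * Complex.I) ^ m * m.factorial * (l.factorial * (2 * Complex.I) ^ l) := by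
  induction m with
  | zero => simp [legR, eval_I_legU]
  | succ m ih =>
    rw [legR]
    simp [ih, Nat.factorial_succ]
    ring

theorem legR_succ_self (l : ℕ) : legR l (l + 1) = C (4 ^ l * (l.factorial : ℂ) ^ 2) := by
  have h := eq_C_of_natDegree_eq_zero (derivative_eq_zero.1 (derivative_legR_succ_self l))
  have h2 := eval_I_legR l l
  rw [h, eval_C] at h2
  rw [h, h2]
  congr 1
  have : (-2 * Complex.I) ^ l * (2 * Complex.I) ^ l = 4 ^ l := by
    rw [← mul_pow]
    congr 1
    linear_combination -4 * Complex.I_sq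
  linear_combination (l.factorial : ℂ) ^ 2 * this

theorem one_add_ofReal_sq_ne_zero (x : ℝ) : (1 + (x : ℂ) ^ 2) ≠ 0 := by
  have : (1 + x ^ 2 : ℝ) ≠ 0 := by positivity
  exact_mod_cast this

theorem hasDerivAt_eval_ofReal (p : ℂ[X]) (x : ℝ) :
    HasDerivAt (fun t : ℝ => p.eval (t : ℂ)) ((derivative p).eval (x : ℂ)) x :=
  (p.hasDerivAt (x : ℂ)).comp_ofReal

theorem hasDerivAt_eval_div (p : ℂ[X]) (m : ℕ) (x : ℝ) :
    HasDerivAt (fun t : ℝ => p.eval (t : ℂ) / (1 + (t : ℂ) ^ 2) ^ m)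
      (((1 + X ^ 2) * derivative p - 2 * (m : ℂ[X]) * X * p).eval (x : ℂ)
        / (1 + (x : ℂ) ^ 2) ^ (m + 1)) x := by
  have hx := one_add_ofReal_sq_ne_zero x
  have h := (hasDerivAt_eval_ofReal p x).div (hasDerivAt_eval_ofReal ((1 + X ^ 2) ^ m) x)
    (by simpa using pow_ne_zero m hx)
  simp only [eval_pow, eval_add, eval_one, eval_X] at h
  refine h.congr_deriv ?_
  cases m with
  | zero => simp; field_simp
  | succ m =>
    simp [derivative_pow, map_ofNat]
    field_simp
    ring

theorem hasDerivAt_arctan_ofReal (x : ℝ) :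
    HasDerivAt (fun t : ℝ => (Real.arctan t : ℂ)) (1 / (1 + (x : ℂ) ^ 2)) x := by
  simpa using (Real.hasDerivAt_arctan x).ofReal_comp

theorem iteratedDeriv_eq_of_hasDerivAt {𝕜 E : Type*} [NontriviallyNormedField 𝕜]
    [NormedAddCommGroup E] [NormedSpace 𝕜 E] {f : ℕ → 𝕜 → E}
    (h : ∀ n x, HasDerivAt (f n) (f (n + 1) x) x) (n : ℕ) : iteratedDeriv n (f 0) = f n := by
  induction n with
  | zero => simp
  | succ n ih =>
    rw [iteratedDeriv_succ, ih]
    exact funext fun x => (h n x).deriv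

theorem iteratedDeriv_legU_mul_arctan {l k : ℕ} (h : l < k) (c : ℂ) (W : ℂ[X])
    (hW : W.natDegree ≤ l) (x : ℝ) :
    iteratedDeriv k (fun t : ℝ => c * ((legU l l).eval (t : ℂ) * (Real.arctan t : ℂ))
      - W.eval (t : ℂ)) x = c * ((legR l k).eval (x : ℂ) / (1 + (x : ℂ) ^ 2) ^ k) := by
  let f : ℕ → ℝ → ℂ := fun m t =>
    c * ((legU l (l + m)).eval (t : ℂ) * (Real.arctan t : ℂ)
      + (legR l m).eval (t : ℂ) / (1 + (t : ℂ) ^ 2) ^ m) - (derivative^[m] W).eval (t : ℂ)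
  have hf : ∀ n x, HasDerivAt (f n) (f (n + 1) x) x := by
    intro n x
    have hx := one_add_ofReal_sq_ne_zero x
    have h := ((((hasDerivAt_eval_ofReal (legU l (l + n)) x).mul
      (hasDerivAt_arctan_ofReal x)).add (hasDerivAt_eval_div (legR l n) n x)).const_mul c).sub
        (hasDerivAt_eval_ofReal (derivative^[n] W) x)
    refine h.congr_deriv ?_
    simp only [f, Function.iterate_succ_apply', derivative_legU, legR, ← add_assoc]
    simp
    field_simp
    left
    ring
  have h0 : (fun t : ℝ => c * ((legU l l).eval (t : ℂ) * (Real.arctan t : ℂ))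
      - W.eval (t : ℂ)) = f 0 := by
    funext t
    simp [f, legR]
  rw [h0, iteratedDeriv_eq_of_hasDerivAt hf]
  simp [f, legU_eq_zero (show 2 * l < l + k by omega),
    iterate_derivative_eq_zero (hW.trans_lt h)]

theorem iteratedDeriv_eval (p : ℂ[X]) (n : ℕ) :
    iteratedDeriv n (fun w => p.eval w) = fun w => (derivative^[n] p).eval w :=
  iteratedDeriv_eq_of_hasDerivAt (f := fun n w => (derivative^[n] p).eval w)
    (fun n x => by simpa only [Function.iterate_succ_apply'] using
      (derivative^[n] p).hasDerivAt x) n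

theorem iterate_derivative_comp_C_mul_X (p : ℂ[X]) (a : ℂ) (n : ℕ) :
    derivative^[n] (p.comp (C a * X)) = C a ^ n * (derivative^[n] p).comp (C a * X) := by
  induction n with
  | zero => simp
  | succ n ih =>
    simp only [Function.iterate_succ_apply', ih, ← C_pow, derivative_C_mul, derivative_comp]
    simp
    ring

theorem legU_self_eq_comp (l : ℕ) : legU l l =
    (-1) ^ l * (C Complex.I ^ l * (derivative^[l] ((X ^ 2 - 1 : ℂ[X]) ^ l)).comp (C Complex.I * X)) := by
  have h : ((1 + X ^ 2) ^ l : ℂ[X]) = C ((-1) ^ l) * ((X ^ 2 - 1 : ℂ[X]) ^ l).comp (C Complex.I * X) := by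
    have : (C Complex.I ^ 2 : ℂ[X]) = -1 := by rw [← C_pow]; simp
    simp only [pow_comp, sub_comp, X_comp, one_comp, C_pow, C_neg, C_1]
    rw [← mul_pow]
    congr 1
    linear_combination X ^ 2 * this
  rw [legU, h, iterate_derivative_C_mul, iterate_derivative_comp_C_mul_X]
  simp

theorem legP_I_mul (l : ℕ) (x : ℂ) :
    legP l (Complex.I * x) =
      (C (Complex.I ^ l / (2 ^ l * (l.factorial : ℂ))) * legU l l).eval x := by
  have h : (fun w : ℂ => (w ^ 2 - 1) ^ l) = fun w => ((X ^ 2 - 1 : ℂ[X]) ^ l).eval w := by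
    simp
  have h2 : Complex.I ^ l * Complex.I ^ l * (-1) ^ l = 1 := by
    rw [← mul_pow, ← mul_pow]; simp
  rw [legP, h, iteratedDeriv_eval, legU_self_eq_comp]
  simp only [eval_mul, eval_C, eval_pow, eval_neg, eval_one, eval_comp, eval_X]
  linear_combination -(1 / (2 ^ l * (l.factorial : ℂ))) *
    eval (Complex.I * x) (derivative^[l] ((X ^ 2 - 1) ^ l)) * h2

theorem natDegree_legU_self_le (l : ℕ) : (legU l l).natDegree ≤ l := by
  have h1 := natDegree_iterate_derivative ((1 + X ^ 2 : ℂ[X]) ^ l) l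
  have h2 := natDegree_one_add_X_sq_pow_le l
  rw [legU]
  omega

theorem log_one_add_I_mul_div (x : ℝ) :
    Complex.log ((1 + Complex.I * x) / (1 - Complex.I * x)) = 2 * Complex.I * Real.arctan x := by
  rw [Complex.ofReal_arctan, Complex.arctan, mul_comm Complex.I]
  linear_combination Complex.log ((1 + x * Complex.I) / (1 - x * Complex.I)) * Complex.I_sq

theorem exists_legQ_I_mul (l : ℕ) : ∃ W : ℂ[X], W.natDegree ≤ l ∧ ∀ t : ℝ,
    legQ l (Complex.I * t) = Complex.I ^ (l + 1) / (2 ^ l * (l.factorial : ℂ)) *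
      ((legU l l).eval (t : ℂ) * (Real.arctan t : ℂ)) - W.eval (t : ℂ) := by
  let P : ℕ → ℂ[X] := fun l => C (Complex.I ^ l / (2 ^ l * (l.factorial : ℂ))) * legU l l
  have hP : ∀ l, (P l).natDegree ≤ l := fun l =>
    (natDegree_C_mul_le _ _).trans (natDegree_legU_self_le l)
  refine ⟨∑ j ∈ Finset.Icc 1 l, P (j - 1) * P (l - j) * C (j : ℂ)⁻¹,
    natDegree_sum_le_of_forall_le _ _ fun j hj => ?_, fun t => ?_⟩
  · rw [Finset.mem_Icc] at hj
    have h1 := natDegree_mul_C_le (P (j - 1) * P (l - j)) (j : ℂ)⁻¹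
    have h2 := natDegree_mul_le (p := P (j - 1)) (q := P (l - j))
    have h3 := hP (j - 1)
    have h4 := hP (l - j)
    omega
  · rw [legQ, log_one_add_I_mul_div]
    simp only [legP_I_mul, eval_finsetSum, eval_mul, P, eval_C, div_eq_mul_inv]
    congr 1
    ring

theorem iteratedDeriv_legQ {l k : ℕ} (h : l < k) (x : ℝ) :
    iteratedDeriv k (fun t : ℝ => legQ l (Complex.I * t)) x =
      Complex.I ^ (l + 1) / (2 ^ l * (l.factorial : ℂ)) *
        ((legR l k).eval (x : ℂ) / (1 + (x : ℂ) ^ 2) ^ k) := by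
  obtain ⟨W, hW, hQ⟩ := exists_legQ_I_mul l
  rw [funext hQ, iteratedDeriv_legU_mul_arctan h _ W hW]

theorem Qi_mul_Qi {k l l' : ℕ} (hl : l < k) (hl' : l' < k) (x : ℝ) :
    Qi k l x * Qi k l' x = (-1) ^ k * (Complex.I ^ (l + 1) / (2 ^ l * (l.factorial : ℂ))) *
      (Complex.I ^ (l' + 1) / (2 ^ l' * (l'.factorial : ℂ))) *
        ((legR l k * legR l' k).eval (x : ℂ) / (1 + (x : ℂ) ^ 2) ^ k) := by
  have hx := one_add_ofReal_sq_ne_zero x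
  have h1 : ((((1 + x ^ 2) ^ ((k : ℝ) / 2) : ℝ) : ℂ)) ^ 2 = (1 + (x : ℂ) ^ 2) ^ k := by
    have : ((1 + x ^ 2) ^ ((k : ℝ) / 2)) ^ 2 = (1 + x ^ 2) ^ k := by
      rw [← Real.rpow_mul_natCast (by positivity), ← Real.rpow_natCast _ k]
      congr 1
      push_cast
      ring
    exact_mod_cast this
  have h2 : (Complex.I ^ (-(k : ℤ))) ^ 2 = (-1) ^ k := by
    rw [zpow_neg, zpow_natCast, inv_pow, ← pow_mul, mul_comm, pow_mul, Complex.I_sq,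
      ← inv_pow]
    norm_num
  have h3 : ((-1 : ℂ) ^ k) ^ 2 = 1 := by rw [← pow_mul, mul_comm, pow_mul]; simp
  rw [Qi, Qi, iteratedDeriv_legQ hl, iteratedDeriv_legQ hl']
  generalize Complex.I ^ (-(k : ℤ)) = a at *
  generalize ((((1 + x ^ 2) ^ ((k : ℝ) / 2) : ℝ) : ℂ)) = b at *
  generalize Complex.I ^ (l + 1) / (2 ^ l * (l.factorial : ℂ)) = c at *
  generalize Complex.I ^ (l' + 1) / (2 ^ l' * (l'.factorial : ℂ)) = c' at *
  rw [eval_mul]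
  calc _ = (((-1 : ℂ) ^ k) ^ 2) * b ^ 2 * a ^ 2 * c * c' * (eval (x : ℂ) (legR l k) /
        (1 + (x : ℂ) ^ 2) ^ k) * (eval (x : ℂ) (legR l' k) / (1 + (x : ℂ) ^ 2) ^ k) := by ring
    _ = _ := by
      rw [h1, h2, h3]
      field_simp

theorem exists_norm_eval_le {p : ℂ[X]} {n : ℕ} (hp : p.natDegree ≤ n) :
    ∃ K : ℝ, ∀ x : ℝ, ‖p.eval (x : ℂ)‖ ≤ K * √(1 + x ^ 2) ^ n := by
  refine ⟨∑ i ∈ Finset.range (n + 1), ‖p.coeff i‖, fun x => ?_⟩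
  rw [eval_eq_sum_range' (Nat.lt_succ_of_le hp), Finset.sum_mul]
  refine norm_sum_le_of_le _ fun i hi => ?_
  rw [norm_mul, norm_pow, Complex.norm_real, Real.norm_eq_abs]
  have h1 : |x| ≤ √(1 + x ^ 2) := Real.abs_le_sqrt (by linarith)
  have h2 : 1 ≤ √(1 + x ^ 2) := Real.one_le_sqrt.2 (by nlinarith)
  gcongr
  exact (pow_le_pow_left₀ (abs_nonneg x) h1 i).trans
    (pow_le_pow_right₀ h2 (by simp at hi; omega))

theorem norm_one_add_sq_pow (x : ℝ) (k : ℕ) :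
    ‖(1 + (x : ℂ) ^ 2) ^ k‖ = √(1 + x ^ 2) ^ (2 * k) := by
  rw [pow_mul, Real.sq_sqrt (by positivity), norm_pow]
  congr 1
  rw [show (1 + (x : ℂ) ^ 2) = ((1 + x ^ 2 : ℝ) : ℂ) by push_cast; rfl, Complex.norm_real,
    Real.norm_of_nonneg (by positivity)]

theorem continuous_eval_div (p : ℂ[X]) (k : ℕ) :
    Continuous fun x : ℝ => p.eval (x : ℂ) / (1 + (x : ℂ) ^ 2) ^ k :=
  continuous_iff_continuousAt.2 fun x => (hasDerivAt_eval_div p k x).continuousAt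

theorem integrable_eval_div {p : ℂ[X]} {k : ℕ} (hp : p.natDegree + 2 ≤ 2 * k) :
    Integrable (fun x : ℝ => p.eval (x : ℂ) / (1 + (x : ℂ) ^ 2) ^ k) := by
  obtain ⟨K, hK⟩ := exists_norm_eval_le (p := p) (n := 2 * k - 2) (by omega)
  refine (integrable_inv_one_add_sq.const_mul K).mono'
    (continuous_eval_div p k).aestronglyMeasurable (Eventually.of_forall fun x => ?_)
  have h0 : 0 < √(1 + x ^ 2) := by positivity
  rw [norm_div, norm_one_add_sq_pow, div_le_iff₀ (by positivity)]
  refine (hK x).trans_eq ?_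
  rw [mul_assoc]
  congr 1
  nth_rewrite 2 [show 1 + x ^ 2 = √(1 + x ^ 2) ^ 2 from (Real.sq_sqrt (by positivity)).symm]
  rw [show 2 * k = (2 * k - 2) + 2 by omega, pow_add]
  field_simp
  simp

theorem tendsto_eval_div {p : ℂ[X]} {k : ℕ} (hp : p.natDegree < 2 * k) :
    Tendsto (fun x : ℝ => p.eval (x : ℂ) / (1 + (x : ℂ) ^ 2) ^ k) (Bornology.cobounded ℝ)
      (nhds 0) := by
  obtain ⟨K, hK⟩ := exists_norm_eval_le (p := p) (n := 2 * k - 1) (by omega)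
  have hlim : Tendsto (fun x : ℝ => |K| * ‖x‖⁻¹) (Bornology.cobounded ℝ) (nhds 0) := by
    simpa using (tendsto_inv_atTop_zero.comp (tendsto_norm_cobounded_atTop (E := ℝ))).const_mul |K|
  refine squeeze_zero_norm' ?_ hlim
  filter_upwards [(tendsto_norm_cobounded_atTop (E := ℝ)).eventually_gt_atTop 0] with x hx
  have h0 : 0 < √(1 + x ^ 2) := by positivity
  have h1 : ‖x‖ ≤ √(1 + x ^ 2) := Real.abs_le_sqrt (by linarith)
  calc ‖p.eval (x : ℂ) / (1 + (x : ℂ) ^ 2) ^ k‖ ≤ |K| * (√(1 + x ^ 2))⁻¹ := by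
        rw [norm_div, norm_one_add_sq_pow, div_le_iff₀ (by positivity)]
        refine (hK x).trans ((mul_le_mul_of_nonneg_right (le_abs_self K) (by positivity)).trans_eq ?_)
        nth_rewrite 2 [show 2 * k = (2 * k - 1) + 1 by omega]
        rw [pow_succ]
        field_simp
        ring
    _ ≤ |K| * ‖x‖⁻¹ := by gcongr

theorem integral_derivative_eval_div {p : ℂ[X]} {k : ℕ} (hp : p.natDegree < 2 * k)
    {f : ℝ → ℂ} (hf : Integrable f)
    (h : ∀ x : ℝ, ((1 + X ^ 2) * derivative p - 2 * (k : ℂ[X]) * X * p).eval (x : ℂ)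
        / (1 + (x : ℂ) ^ 2) ^ (k + 1) = f x) : ∫ x, f x = 0 := by
  have hlim := tendsto_eval_div hp
  rw [integral_of_hasDerivAt_of_tendsto (fun x => h x ▸ hasDerivAt_eval_div p k x) hf
    (hlim.mono_left IsOrderBornology.atBot_le_cobounded)
    (hlim.mono_left IsOrderBornology.atTop_le_cobounded), sub_zero]

theorem integral_one_div_one_add_sq_pow (n : ℕ) :
    ∫ x : ℝ, (1 : ℂ[X]).eval (x : ℂ) / (1 + (x : ℂ) ^ 2) ^ (n + 1) =
      Real.pi * (2 * n).factorial / (4 ^ n * (n.factorial : ℂ) ^ 2) := by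
  induction n with
  | zero =>
    have h := congrArg ((↑) : ℝ → ℂ) integral_univ_inv_one_add_sq
    rw [← integral_complex_ofReal] at h
    simpa using h
  | succ n ih =>
    have i1 := integrable_eval_div (p := 1) (k := n + 1) (by rw [natDegree_one]; omega)
    have i2 := integrable_eval_div (p := 1) (k := n + 2) (by rw [natDegree_one]; omega)
    have h := integral_derivative_eval_div (p := X) (k := n + 1) (by rw [natDegree_X]; omega)
      (f := fun x : ℝ => (2 * (n : ℂ) + 2) * (eval (x : ℂ) (1 : ℂ[X]) / (1 + (x : ℂ) ^ 2) ^ (n + 2))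
        - (2 * (n : ℂ) + 1) * (eval (x : ℂ) (1 : ℂ[X]) / (1 + (x : ℂ) ^ 2) ^ (n + 1)))
      ((i2.const_mul _).sub (i1.const_mul _)) (fun x => by
        have hx := one_add_ofReal_sq_ne_zero x
        simp
        field_simp
        ring)
    rw [integral_sub (i2.const_mul _) (i1.const_mul _), integral_const_mul, integral_const_mul,
      ih] at h
    have hn : (n : ℂ) + 1 ≠ 0 := by exact_mod_cast n.succ_ne_zero
    have hf : (n.factorial : ℂ) ≠ 0 := by exact_mod_cast n.factorial_ne_zero
    rw [show 2 * (n + 1) = 2 * n + 1 + 1 by ring]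
    simp only [Nat.factorial_succ]
    push_cast
    refine mul_left_cancel₀ (mul_ne_zero two_ne_zero hn) ?_
    rw [show (2 * ((n : ℂ) + 1)) = 2 * n + 2 by ring, sub_eq_zero.1 h]
    field_simp
    ring

theorem natDegree_legR_mul_legR {k l l' : ℕ} (hl : l < k) (hl' : l' < k) :
    (legR l k * legR l' k).natDegree + 2 ≤ 2 * k := by
  obtain ⟨m, rfl⟩ := Nat.exists_eq_add_of_le (Nat.succ_le_of_lt hl)
  obtain ⟨m', hm'⟩ := Nat.exists_eq_add_of_le (Nat.succ_le_of_lt hl')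
  have h := natDegree_mul_le (p := legR l (l.succ + m)) (q := legR l' (l.succ + m))
  have h1 := natDegree_legR_le l m
  have h2 := natDegree_legR_le l' m'
  rw [← Nat.succ_eq_add_one, ← hm'] at h2
  rw [← Nat.succ_eq_add_one] at h1
  omega

theorem integral_legR_mul_legR_succ {k l l' : ℕ} (hl : l < k) (hl' : l' < k) :
    ∫ x : ℝ, (legR l (k + 1) * legR l' (k + 1)).eval (x : ℂ) / (1 + (x : ℂ) ^ 2) ^ (k + 1) =
      ((k : ℂ) - l) * ((k : ℂ) + l + 1) *
        ∫ x : ℝ, (legR l k * legR l' k).eval (x : ℂ) / (1 + (x : ℂ) ^ 2) ^ k := by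
  have i1 := integrable_eval_div (natDegree_legR_mul_legR hl hl')
  have i2 := integrable_eval_div (natDegree_legR_mul_legR (Nat.lt_succ_of_lt hl)
    (Nat.lt_succ_of_lt hl'))
  have hdeg : (legR l (k + 1) * legR l' k).natDegree < 2 * k := by
    obtain ⟨m, hm⟩ := Nat.exists_eq_add_of_le (Nat.succ_le_of_lt hl)
    obtain ⟨m', hm'⟩ := Nat.exists_eq_add_of_le (Nat.succ_le_of_lt hl')
    have h := natDegree_mul_le (p := legR l (k + 1)) (q := legR l' k)
    have h1 := natDegree_legR_le l (m + 1)
    have h2 := natDegree_legR_le l' m'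
    rw [show l + 1 + (m + 1) = k + 1 by omega] at h1
    rw [show l' + 1 + m' = k by omega] at h2
    omega
  have h := integral_derivative_eval_div hdeg (i2.sub (i1.const_mul
    (((k : ℂ) - l) * ((k : ℂ) + l + 1)))) (fun x => by
      have hx := one_add_ofReal_sq_ne_zero x
      have e1 : (1 + X ^ 2) * derivative (legR l (k + 1) * legR l' k)
          - 2 * (k : ℂ[X]) * X * (legR l (k + 1) * legR l' k)
          = legR l (k + 1) * legR l' (k + 1)
            - ((k : ℂ[X]) - (l : ℂ[X])) * ((k : ℂ[X]) + (l : ℂ[X]) + 1) * (1 + X ^ 2) * (legR l k * legR l' k) := by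
        have h1 := legR_ode_of_le hl.le
        rw [legR_succ_of_lt (Nat.lt_succ_of_lt hl)] at h1
        push_cast at h1
        rw [legR_succ_of_lt hl', derivative_mul]
        linear_combination legR l' k * h1
      rw [e1]
      simp
      field_simp
      ring)
  simp only [Pi.sub_apply] at h
  rw [integral_sub i2 (i1.const_mul _), integral_const_mul] at h
  exact sub_eq_zero.1 h

theorem integral_legR_mul_legR_of_ne {k l l' : ℕ} (hl : l < k) (hl' : l' < k) (hne : l ≠ l') :
    ∫ x : ℝ, (legR l k * legR l' k).eval (x : ℂ) / (1 + (x : ℂ) ^ 2) ^ k = 0 := by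
  have h1 := integral_legR_mul_legR_succ hl hl'
  have h2 := integral_legR_mul_legR_succ hl' hl
  simp only [mul_comm (legR l' _)] at h2
  have h3 : ((l : ℂ) - l') ≠ 0 := sub_ne_zero.2 (by exact_mod_cast hne)
  have h4 : ((l : ℂ) + l' + 1) ≠ 0 := by exact_mod_cast (l + l').succ_ne_zero
  refine (mul_eq_zero.1 ?_).resolve_left (mul_ne_zero h3 h4)
  linear_combination h1 - h2

theorem integral_legR_sq (l m : ℕ) :
    (-1) ^ m * ∫ x : ℝ, (legR l (l + 1 + m) * legR l (l + 1 + m)).eval (x : ℂ)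
        / (1 + (x : ℂ) ^ 2) ^ (l + 1 + m) =
      4 ^ l * (l.factorial : ℂ) ^ 2 * (2 * l).factorial * Real.pi *
        (((∏ i ∈ Finset.Icc (l + 2) (l + 1 + m),
          (((l : ℤ) + (i : ℤ)) * ((l : ℤ) - (i : ℤ) + 1))) : ℤ) : ℂ) := by
  induction m with
  | zero =>
    have hf : (l.factorial : ℂ) ≠ 0 := by exact_mod_cast l.factorial_ne_zero
    have h := integral_one_div_one_add_sq_pow l
    simp only [eval_one] at h
    simp only [add_zero, legR_succ_self, eval_mul, eval_C]
    rw [Finset.Icc_eq_empty (by omega), Finset.prod_empty]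
    conv_lhs => enter [2, 2, x]; rw [div_eq_mul_one_div]
    rw [integral_const_mul, h]
    field_simp
    simp
  | succ m ih =>
    rw [← add_assoc, integral_legR_mul_legR_succ (by omega) (by omega),
      Finset.prod_Icc_succ_top (by omega)]
    rw [Int.cast_mul]
    push_cast at ih ⊢
    linear_combination -((m : ℂ) + 1) * (2 * (l : ℂ) + 2 + m) * ih

end

/-- Orthogonality and normalization of `Q^k_ℓ(i·x)` for `ℓ, ℓ' < k`. -/
theorem legendreQ_imag_orthogonality (k l l' : ℕ) (hl : l < k) (hl' : l' < k) :
    Integrable (fun x : ℝ => Qi k l x * Qi k l' x) volume ∧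
    ∫ x : ℝ, Qi k l x * Qi k l' x =
      if l = l' then
        (((2 * l).factorial : ℂ)) * (Real.pi : ℂ) *
          (((∏ i ∈ Finset.Icc (l + 2) k, (((l : ℤ) + (i : ℤ)) * ((l : ℤ) - (i : ℤ) + 1))) : ℤ) : ℂ)
      else 0 := by
  simp only [Qi_mul_Qi hl hl']
  refine ⟨(integrable_eval_div (natDegree_legR_mul_legR hl hl')).const_mul _, ?_⟩
  rw [integral_const_mul]
  split_ifs with h
  · subst h
    obtain ⟨m, rfl⟩ := Nat.exists_eq_add_of_le (Nat.succ_le_of_lt hl)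
    have hf : (l.factorial : ℂ) ≠ 0 := by exact_mod_cast l.factorial_ne_zero
    have hI : Complex.I ^ (l + 1) * Complex.I ^ (l + 1) = (-1) ^ (l + 1) := by
      rw [← mul_pow, Complex.I_mul_I]
    have h1 : ((-1 : ℂ) ^ (l + 1)) * (-1) ^ (l + 1) = 1 := by rw [← mul_pow]; simp
    have h2 : (2 : ℂ) ^ l * 2 ^ l = 4 ^ l := by rw [← mul_pow]; norm_num
    have h3 := integral_legR_sq l m
    simp only [Nat.succ_eq_add_one] at h3 ⊢
    generalize (∫ x : ℝ, (legR l (l + 1 + m) * legR l (l + 1 + m)).eval (x : ℂ)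
        / (1 + (x : ℂ) ^ 2) ^ (l + 1 + m)) = J at h3 ⊢
    calc _ = ((-1 : ℂ) ^ (l + 1)) * (Complex.I ^ (l + 1) * Complex.I ^ (l + 1)) *
          ((-1) ^ m * J) / ((2 ^ l * 2 ^ l) * (l.factorial : ℂ) ^ 2) := by
          rw [pow_add (-1 : ℂ) (l + 1) m]
          field_simp
      _ = _ := by
          rw [hI, h1, h2, h3]
          field_simp
  · rw [integral_legR_mul_legR_of_ne hl hl' h, mul_zero]
end

section
/- For every natural number ℓ, ∫_{-∞}^{+∞} (Q^{ℓ+1}_ℓ(i·x))² dx = (2ℓ)!·π. -/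
open MeasureTheory Filter Finset

namespace LegQ
open Polynomial

/-- The Legendre polynomial `P_ℓ` as an element of `ℂ[X]`. -/
noncomputable def legPoly (l : ℕ) : ℂ[X] :=
  C (1 / (2 ^ l * (l.factorial : ℂ))) * derivative^[l] ((X ^ 2 - 1) ^ l)

theorem iteratedDeriv_eval (p : ℂ[X]) (n : ℕ) :
    iteratedDeriv n (fun w : ℂ => p.eval w) = fun w => (derivative^[n] p).eval w := by
  induction n with
  | zero => simp
  | succ n ih =>
    rw [iteratedDeriv_succ, ih, Function.iterate_succ_apply']
    funext w
    exact Polynomial.deriv _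

theorem legP_eq_eval (l : ℕ) (z : ℂ) : legP l z = (legPoly l).eval z := by
  have h := congrFun (iteratedDeriv_eval ((X ^ 2 - 1) ^ l) l) z
  simp only [eval_pow, eval_sub, eval_X, eval_one] at h
  rw [legP, legPoly, h, eval_mul, eval_C]

theorem natDegree_legPoly_le (l : ℕ) : (legPoly l).natDegree ≤ l := by
  refine (natDegree_C_mul_le _ _).trans ((natDegree_iterate_derivative _ _).trans ?_)
  have h : ((X ^ 2 - 1 : ℂ[X]) ^ l).natDegree ≤ l * 2 := by
    refine natDegree_pow_le_of_le l ?_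
    compute_degree
  omega

theorem legPoly_eval_one (l : ℕ) : (legPoly l).eval 1 = 1 := by
  have h := aeval_iterate_derivative_self ((X ^ 2 - 1 : ℂ[X]) ^ l) l (r := (1 : ℂ))
    (p' := (X + 1) ^ l) (by simp [← mul_pow]; ring)
  simp only [coe_aeval_eq_eval, eval_pow, eval_add, eval_X, eval_one, nsmul_eq_mul] at h
  rw [legPoly, eval_mul, eval_C, h]
  have : (l.factorial : ℂ) ≠ 0 := by exact_mod_cast l.factorial_ne_zero
  norm_num
  field_simp

theorem iterate_derivative_sq_sub_one_pow (l m : ℕ) :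
    (X ^ 2 - 1 : ℂ[X]) * derivative^[m + 2] ((X ^ 2 - 1) ^ l)
      + 2 * (m + 1 - l : ℂ[X]) * X * derivative^[m + 1] ((X ^ 2 - 1) ^ l)
      + (m + 1 : ℂ[X]) * (m - 2 * l : ℂ[X]) * derivative^[m] ((X ^ 2 - 1) ^ l) = 0 := by
  set u : ℂ[X] := (X ^ 2 - 1) ^ l with hu
  induction m with
  | zero =>
    have h1 : (X ^ 2 - 1 : ℂ[X]) * derivative u = 2 * (l : ℂ[X]) * X * u := by
      rw [hu]
      rcases l with _ | l
      · simp
      · simp only [derivative_pow, derivative_sub, derivative_X, derivative_one,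
          Nat.add_sub_cancel]
        simp [show (C 2 : ℂ[X]) = 2 from rfl]
        ring
    have h2 := congrArg derivative h1
    simp at h2 ⊢
    linear_combination h2
  | succ m ih =>
    have h2 := congrArg derivative ih
    simp only [Function.iterate_succ_apply'] at h2 ⊢
    simp at h2 ⊢
    linear_combination h2

theorem iterate_derivative_legPoly (l n : ℕ) :
    (1 - X ^ 2 : ℂ[X]) * derivative^[n + 2] (legPoly l)
      - 2 * (n + 1 : ℂ[X]) * X * derivative^[n + 1] (legPoly l)
      + (l * (l + 1) - n * (n + 1) : ℂ[X]) * derivative^[n] (legPoly l) = 0 := by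
  have h := iterate_derivative_sq_sub_one_pow l (n + l)
  simp only [legPoly, iterate_derivative_C_mul, ← Function.iterate_add_apply]
  rw [show n + 2 + l = n + l + 2 by ring, show n + 1 + l = n + l + 1 by ring]
  push_cast at h
  linear_combination (-C (1 / (2 ^ l * (l.factorial : ℂ)))) * h

/-- Numerators of the rational parts of the derivatives of `P * artanh`: the `(n+1)`-st derivative
has rational part `artanhNum P n / (1 - X ^ 2) ^ (n + 1)`. -/
noncomputable def artanhNum (P : ℂ[X]) : ℕ → ℂ[X]
  | 0 => P
  | n + 1 => (1 - X ^ 2) ^ (n + 1) * derivative^[n + 1] P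
      + (1 - X ^ 2) * derivative (artanhNum P n) + 2 * (n + 1 : ℂ[X]) * X * artanhNum P n

theorem artanhNum_eval_one (P : ℂ[X]) (n : ℕ) :
    (artanhNum P n).eval 1 = 2 ^ n * n.factorial * P.eval 1 := by
  induction n with
  | zero => simp [artanhNum]
  | succ n ih =>
    simp [artanhNum, ih, Nat.factorial_succ]
    ring

theorem derivative_artanhNum_legPoly (l n : ℕ) :
    derivative (artanhNum (legPoly l) (n + 1)) =
      (1 - X ^ 2) ^ (n + 1) * derivative^[n + 2] (legPoly l)
        - (l * (l + 1) - (n + 1) * (n + 2) : ℂ[X]) * artanhNum (legPoly l) n := by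
  induction n with
  | zero =>
    have h := iterate_derivative_legPoly l 0
    simp only [artanhNum, Function.iterate_succ_apply', Function.iterate_zero_apply] at h ⊢
    simp at h ⊢
    linear_combination h
  | succ n ih =>
    have h := iterate_derivative_legPoly l (n + 1)
    have e : artanhNum (legPoly l) (n + 2) =
        2 * (1 - X ^ 2) ^ (n + 2) * derivative^[n + 2] (legPoly l)
          + 2 * (n + 2 : ℂ[X]) * X * artanhNum (legPoly l) (n + 1)
          - (l * (l + 1) - (n + 1) * (n + 2) : ℂ[X]) * (1 - X ^ 2) * artanhNum (legPoly l) n := by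
      rw [artanhNum, ih]
      push_cast
      ring
    have e' : artanhNum (legPoly l) (n + 1) = (1 - X ^ 2) ^ (n + 1) * derivative^[n + 1] (legPoly l)
      + (1 - X ^ 2) * derivative (artanhNum (legPoly l) n)
      + 2 * (n + 1 : ℂ[X]) * X * artanhNum (legPoly l) n := by rw [artanhNum]
    have ed := congrArg derivative e
    simp only [derivative_sub, derivative_add, derivative_mul, ih, derivative_pow] at ed
    simp only [Function.iterate_succ_apply'] at ed h e' ih ⊢
    rw [ed]
    simp [show (C 2 : ℂ[X]) = 2 from rfl] at h e' ⊢
    linear_combination ((1 - X ^ 2) ^ (n + 1)) * h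
      + (l * (l + 1) - (n + 1) * (n + 2) : ℂ[X]) * e'

theorem artanhNum_legPoly_self (l : ℕ) :
    artanhNum (legPoly l) l = C (2 ^ l * (l.factorial : ℂ)) := by
  have hd : derivative (artanhNum (legPoly l) l) = 0 := by
    rcases l with _ | n
    · simp [artanhNum, legPoly]
    · rw [derivative_artanhNum_legPoly, iterate_derivative_eq_zero]
      · push_cast
        ring
      · have := natDegree_legPoly_le (n + 1)
        omega
  have h1 := artanhNum_eval_one (legPoly l) l
  rw [eq_C_of_derivative_eq_zero hd] at h1 ⊢
  simp only [eval_C, legPoly_eval_one, mul_one] at h1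
  rw [h1]

theorem one_sub_sq_ne_zero_of_mem_slitPlane {z : ℂ}
    (hz : (1 + z) / (1 - z) ∈ Complex.slitPlane) : 1 - z ^ 2 ≠ 0 := by
  have h := Complex.slitPlane_ne_zero hz
  rw [show 1 - z ^ 2 = (1 + z) * (1 - z) by ring]
  exact mul_ne_zero (left_ne_zero_of_mul h) fun h' => h (by rw [h', div_zero])

theorem hasDerivAt_log_div {z : ℂ} (hz : (1 + z) / (1 - z) ∈ Complex.slitPlane) :
    HasDerivAt (fun w : ℂ => Complex.log ((1 + w) / (1 - w))) (2 / (1 - z ^ 2)) z := by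
  have h3 := one_sub_sq_ne_zero_of_mem_slitPlane hz
  have h12 : (1 + z) * (1 - z) ≠ 0 := by rwa [show (1 + z) * (1 - z) = 1 - z ^ 2 by ring]
  have h1 := left_ne_zero_of_mul h12
  have h2 := right_ne_zero_of_mul h12
  have h := ((((hasDerivAt_id z).const_add 1).div ((hasDerivAt_id z).const_sub 1) h2).clog hz)
  refine h.congr_deriv ?_
  simp only [id, Pi.div_apply]
  field_simp
  ring

theorem one_add_div_one_sub_mem_slitPlane (t : ℝ) :
    (1 + Complex.I * t) / (1 - Complex.I * t) ∈ Complex.slitPlane := by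
  have hpos : 0 < 1 + t * t := by nlinarith [mul_self_nonneg t]
  rw [Complex.mem_slitPlane_iff]
  rcases eq_or_ne t 0 with rfl | ht
  · simp
  · right
    rw [Complex.div_im]
    simp only [Complex.normSq_apply]
    simp
    field_simp
    norm_num
    exact ht

/-- The `(n+1)`-st derivative of `P * artanh - W`, for polynomials `P` and `W`. -/
noncomputable def artanhDeriv (P W : ℂ[X]) (n : ℕ) (z : ℂ) : ℂ :=
  1 / 2 * (derivative^[n + 1] P).eval z * Complex.log ((1 + z) / (1 - z))
    + (artanhNum P n).eval z / (1 - z ^ 2) ^ (n + 1) - (derivative^[n + 1] W).eval z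

theorem hasDerivAt_artanh_mul (P W : ℂ[X]) {z : ℂ} (hz : (1 + z) / (1 - z) ∈ Complex.slitPlane) :
    HasDerivAt (fun w : ℂ => 1 / 2 * P.eval w * Complex.log ((1 + w) / (1 - w)) - W.eval w)
      (artanhDeriv P W 0 z) z := by
  refine ((((P.hasDerivAt z).const_mul (1 / 2)).mul (hasDerivAt_log_div hz)).sub
    (W.hasDerivAt z)).congr_deriv ?_
  simp [artanhDeriv, artanhNum]
  ring

theorem hasDerivAt_artanhDeriv (P W : ℂ[X]) (n : ℕ) {z : ℂ}
    (hz : (1 + z) / (1 - z) ∈ Complex.slitPlane) :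
    HasDerivAt (artanhDeriv P W n) (artanhDeriv P W (n + 1) z) z := by
  have h3 := one_sub_sq_ne_zero_of_mem_slitPlane hz
  have hw : HasDerivAt (fun w : ℂ => (1 - w ^ 2) ^ (n + 1))
      ((n + 1) * (1 - z ^ 2) ^ n * (-(2 * z))) z := by
    refine (((hasDerivAt_pow 2 z).const_sub 1).pow (n + 1)).congr_deriv ?_
    simp
  refine (((((derivative^[n + 1] P).hasDerivAt z).const_mul (1 / 2)).mul
    (hasDerivAt_log_div hz)).add (((artanhNum P n).hasDerivAt z).div hw
      (pow_ne_zero _ h3))).sub ((derivative^[n + 1] W).hasDerivAt z) |>.congr_deriv ?_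
  simp only [artanhDeriv, artanhNum, ← Function.iterate_succ_apply' derivative (n + 1)]
  simp only [eval_add, eval_mul, eval_pow, eval_sub, eval_one, eval_X, eval_natCast, eval_ofNat]
  field_simp
  ring

theorem iteratedDeriv_artanh_mul_imag (P W : ℂ[X]) (n : ℕ) :
    iteratedDeriv (n + 1) (fun t : ℝ => 1 / 2 * P.eval (Complex.I * t) *
      Complex.log ((1 + Complex.I * t) / (1 - Complex.I * t)) - W.eval (Complex.I * t)) =
    fun t : ℝ => Complex.I ^ (n + 1) * artanhDeriv P W n (Complex.I * t) := by
  have hI (t : ℝ) : HasDerivAt (fun s : ℝ => Complex.I * (s : ℂ)) Complex.I t := by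
    simpa using (Complex.ofRealCLM.hasDerivAt (x := t)).const_mul Complex.I
  induction n with
  | zero =>
    rw [zero_add, iteratedDeriv_one]
    funext t
    have h := (hasDerivAt_artanh_mul P W (one_add_div_one_sub_mem_slitPlane t)).comp t (hI t)
    rw [pow_one, mul_comm]
    exact h.deriv
  | succ n ih =>
    rw [iteratedDeriv_succ, ih]
    funext t
    have h := ((hasDerivAt_artanhDeriv P W n (one_add_div_one_sub_mem_slitPlane t)).comp t
      (hI t)).const_mul (Complex.I ^ (n + 1))
    refine h.deriv.trans ?_
    ring

/-- The polynomial part of the Legendre function of the second kind. -/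
noncomputable def legW (l : ℕ) : ℂ[X] :=
  ∑ j ∈ Icc 1 l, C (1 / (j : ℂ)) * (legPoly (j - 1) * legPoly (l - j))

theorem natDegree_legW_le (l : ℕ) : (legW l).natDegree ≤ l := by
  refine natDegree_sum_le_of_forall_le _ _ fun j hj => ?_
  have h1 := natDegree_legPoly_le (j - 1)
  have h2 := natDegree_legPoly_le (l - j)
  have h3 := natDegree_mul_le (p := legPoly (j - 1)) (q := legPoly (l - j))
  have h4 := natDegree_C_mul_le (1 / (j : ℂ)) (legPoly (j - 1) * legPoly (l - j))
  rw [Finset.mem_Icc] at hj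
  omega

theorem legQ_eq (l : ℕ) (z : ℂ) :
    legQ l z = 1 / 2 * (legPoly l).eval z * Complex.log ((1 + z) / (1 - z)) - (legW l).eval z := by
  simp only [legQ, legW, legP_eq_eval, eval_finsetSum, eval_mul, eval_C]
  congr 1
  exact Finset.sum_congr rfl fun j _ => by ring

theorem iteratedDeriv_legQ_imag (l : ℕ) (x : ℝ) :
    iteratedDeriv (l + 1) (fun t : ℝ => legQ l (Complex.I * t)) x =
      Complex.I ^ (l + 1) * (2 ^ l * (l.factorial : ℂ) / (1 + (x : ℂ) ^ 2) ^ (l + 1)) := by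
  simp only [legQ_eq]
  refine (congrFun (iteratedDeriv_artanh_mul_imag (legPoly l) (legW l) l) x).trans ?_
  rw [artanhDeriv, artanhNum_legPoly_self,
    iterate_derivative_eq_zero (Nat.lt_succ_of_le (natDegree_legPoly_le l)),
    iterate_derivative_eq_zero (Nat.lt_succ_of_le (natDegree_legW_le l))]
  simp [mul_pow]

theorem Qi_succ_self_sq (l : ℕ) (x : ℝ) :
    Qi (l + 1) l x ^ 2 = (((2 ^ l * l.factorial) ^ 2 * ((1 + x ^ 2) ^ (l + 1))⁻¹ : ℝ) : ℂ) := by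
  have hpos : 0 < 1 + x ^ 2 := by positivity
  have hne : (1 + (x : ℂ) ^ 2) ≠ 0 := by exact_mod_cast hpos.ne'
  have hr : (((1 + x ^ 2) ^ (((l + 1 : ℕ) : ℝ) / 2) : ℝ) : ℂ) ^ 2 = (1 + (x : ℂ) ^ 2) ^ (l + 1) := by
    rw [← Complex.ofReal_pow, ← Real.rpow_natCast, ← Real.rpow_mul hpos.le]
    rw [Nat.cast_ofNat, div_mul_cancel₀ _ two_ne_zero, Real.rpow_natCast]
    push_cast
    rfl
  have hI : Complex.I ^ (-((l + 1 : ℕ) : ℤ)) * Complex.I ^ (l + 1) = 1 := by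
    rw [zpow_neg, zpow_natCast]
    exact inv_mul_cancel₀ (pow_ne_zero _ Complex.I_ne_zero)
  have hs : ((-1 : ℂ) ^ (l + 1)) ^ 2 = 1 := by rw [← pow_mul, mul_comm, pow_mul]; simp
  rw [Qi, iteratedDeriv_legQ_imag]
  rw [show ∀ a b c d e : ℂ, (a * b * c * (d * e)) ^ 2 = a ^ 2 * b ^ 2 * (c * d) ^ 2 * e ^ 2 by
    intros; ring, hI, hs, hr]
  push_cast
  field_simp

theorem integrable_inv_one_add_sq_pow (n : ℕ) :
    Integrable fun x : ℝ => ((1 + x ^ 2) ^ (n + 1))⁻¹ := by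
  refine integrable_inv_one_add_sq.mono' ?_ (ae_of_all _ fun x => ?_)
  · exact (Continuous.inv₀ (by fun_prop) fun x => by positivity).aestronglyMeasurable
  · rw [Real.norm_of_nonneg (by positivity)]
    have h : 1 ≤ 1 + x ^ 2 := by nlinarith [sq_nonneg x]
    gcongr
    exact le_self_pow₀ h (Nat.succ_ne_zero n)

theorem tendsto_mul_inv_one_add_sq_pow_cocompact (n : ℕ) :
    Tendsto (fun x : ℝ => x * ((1 + x ^ 2) ^ (n + 1))⁻¹) (cocompact ℝ) (nhds 0) := by
  have hb : Tendsto (fun x : ℝ => ‖x‖⁻¹) (cocompact ℝ) (nhds 0) :=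
    tendsto_inv_atTop_zero.comp (tendsto_norm_cocompact_atTop (E := ℝ))
  refine squeeze_zero_norm (fun x => ?_) hb
  rcases eq_or_ne x 0 with rfl | hx
  · simp
  have hx' : 0 < ‖x‖ := norm_pos_iff.2 hx
  rw [norm_mul, norm_inv, norm_pow, Real.norm_of_nonneg (show 0 ≤ 1 + x ^ 2 by positivity)]
  rw [← div_eq_mul_inv, div_le_iff₀ (by positivity), inv_mul_eq_div, le_div_iff₀ hx']
  have h : 1 ≤ 1 + x ^ 2 := by nlinarith [sq_nonneg x]
  have h2 : 1 + x ^ 2 ≤ (1 + x ^ 2) ^ (n + 1) := le_self_pow₀ h (Nat.succ_ne_zero n)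
  have h3 : ‖x‖ * ‖x‖ = x ^ 2 := by rw [Real.norm_eq_abs, abs_mul_abs_self, sq]
  linarith

theorem integral_inv_one_add_sq_pow_succ (n : ℕ) :
    (2 * n + 2 : ℝ) * ∫ x : ℝ, ((1 + x ^ 2) ^ (n + 2))⁻¹ =
      (2 * n + 1 : ℝ) * ∫ x : ℝ, ((1 + x ^ 2) ^ (n + 1))⁻¹ := by
  have hd (x : ℝ) : HasDerivAt (fun x : ℝ => x * ((1 + x ^ 2) ^ (n + 1))⁻¹)
      ((2 * n + 2) * ((1 + x ^ 2) ^ (n + 2))⁻¹ - (2 * n + 1) * ((1 + x ^ 2) ^ (n + 1))⁻¹) x := by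
    have hpos : 1 + x ^ 2 ≠ 0 := by positivity
    refine ((hasDerivAt_id x).mul ((((hasDerivAt_pow 2 x).const_add 1).pow (n + 1)).inv
      (pow_ne_zero _ hpos))).congr_deriv ?_
    simp
    field_simp
    ring
  have hi := (integrable_inv_one_add_sq_pow (n + 1)).const_mul (2 * n + 2 : ℝ)
  have hi' := (integrable_inv_one_add_sq_pow n).const_mul (2 * n + 1 : ℝ)
  have ht := tendsto_mul_inv_one_add_sq_pow_cocompact n
  have h := integral_of_hasDerivAt_of_tendsto hd (hi.sub hi')
    (ht.mono_left atBot_le_cocompact) (ht.mono_left atTop_le_cocompact)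
  rw [integral_sub hi hi', integral_const_mul, integral_const_mul] at h
  linarith

theorem integral_inv_one_add_sq_pow (n : ℕ) :
    (2 ^ n * n.factorial : ℝ) ^ 2 * ∫ x : ℝ, ((1 + x ^ 2) ^ (n + 1))⁻¹ =
      (2 * n).factorial * Real.pi := by
  induction n with
  | zero => simp
  | succ n ih =>
    have h := integral_inv_one_add_sq_pow_succ n
    rw [show 2 * (n + 1) = 2 * n + 1 + 1 by ring, Nat.factorial_succ, Nat.factorial_succ,
      Nat.factorial_succ]
    push_cast
    linear_combination (2 * n + 2) * (2 ^ n * (n.factorial : ℝ)) ^ 2 * h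
      + (2 * n + 2) * (2 * n + 1) * ih

end LegQ

/-- Normalization integral of `Q^{ℓ+1}_ℓ(i·x)`. -/
theorem legendreQ_imag_norm_top (l : ℕ) :
    ∫ x : ℝ, (Qi (l + 1) l x) ^ 2 = (((2 * l).factorial : ℂ)) * (Real.pi : ℂ) := by
  simp only [LegQ.Qi_succ_self_sq]
  rw [integral_complex_ofReal, integral_const_mul, LegQ.integral_inv_one_add_sq_pow]
  push_cast
  rfl
end

section
/- Let k, ℓ be natural numbers with k ≥ ℓ+2. Then ∫_{-∞}^{+∞} (Q^k_ℓ(i·x))² dx = (ℓ+k)·(ℓ−k+1)·∫_{-∞}^{+∞} (Q^{k−1}_ℓ(i·x))² dx (with (ℓ−k+1) interpreted as the integer ℓ−k+1, which is negative here). -/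
open MeasureTheory Filter Finset

/-- The polynomial whose `n`-th derivative is the `n`-th Legendre polynomial (Rodrigues formula). -/
noncomputable def rodriguesPoly (n : ℕ) : Polynomial ℂ :=
  Polynomial.C (1 / (2 ^ n * (n.factorial : ℂ))) * (Polynomial.X ^ 2 - 1) ^ n

/-- The Legendre polynomial as an element of `ℂ[X]`. -/
noncomputable def legendrePoly (n : ℕ) : Polynomial ℂ :=
  Polynomial.derivative^[n] (rodriguesPoly n)

lemma iteratedDeriv_eval_polynomial (p : Polynomial ℂ) (n : ℕ) (z : ℂ) :
    iteratedDeriv n (fun w => p.eval w) z = (Polynomial.derivative^[n] p).eval z := by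
  induction n generalizing p with
  | zero => simp
  | succ n ih =>
    have h : deriv (fun w => p.eval w) = fun w => (Polynomial.derivative p).eval w :=
      funext fun w => p.deriv
    rw [iteratedDeriv_succ', h, ih, Function.iterate_succ_apply]

lemma legP_eq_eval (n : ℕ) (z : ℂ) : legP n z = (legendrePoly n).eval z := by
  have h : (fun w : ℂ => (w ^ 2 - 1) ^ n) =
      fun w => ((Polynomial.X ^ 2 - 1 : Polynomial ℂ) ^ n).eval w := by
    funext w; simp
  rw [legP, h, iteratedDeriv_eval_polynomial, legendrePoly, rodriguesPoly,
    Polynomial.iterate_derivative_C_mul, Polynomial.eval_C_mul]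

lemma derivative_rodriguesPoly_succ (n : ℕ) :
    Polynomial.derivative (rodriguesPoly (n + 1)) = rodriguesPoly n * Polynomial.X := by
  have hc : (1 / (2 ^ (n + 1) * ((n + 1).factorial : ℂ))) * ((n + 1 : ℕ) * 2) =
      1 / (2 ^ n * (n.factorial : ℂ)) := by
    have : (n.factorial : ℂ) ≠ 0 := by exact_mod_cast n.factorial_ne_zero
    have : (n : ℂ) + 1 ≠ 0 := by exact_mod_cast n.succ_ne_zero
    push_cast [Nat.factorial_succ]
    field_simp
    ring
  rw [rodriguesPoly, rodriguesPoly, ← hc, Polynomial.derivative_C_mul, Polynomial.derivative_pow]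
  simp only [Polynomial.derivative_sub, Polynomial.derivative_X_pow, Polynomial.derivative_one,
    map_mul, map_ofNat, map_natCast, add_tsub_cancel_right]
  push_cast
  ring

lemma rodriguesPoly_mul (n : ℕ) :
    rodriguesPoly n * Polynomial.X * Polynomial.X - rodriguesPoly n =
      Polynomial.C (2 * (n + 1) : ℂ) * rodriguesPoly (n + 1) := by
  have hc : (1 / (2 ^ (n + 1) * ((n + 1).factorial : ℂ))) * (2 * (n + 1)) =
      1 / (2 ^ n * (n.factorial : ℂ)) := by
    have : (n.factorial : ℂ) ≠ 0 := by exact_mod_cast n.factorial_ne_zero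
    have : (n : ℂ) + 1 ≠ 0 := by exact_mod_cast n.succ_ne_zero
    push_cast [Nat.factorial_succ]
    field_simp
    ring
  rw [rodriguesPoly, rodriguesPoly, ← hc, Polynomial.C_mul (a := 1 / _)]
  ring

lemma legendrePoly_succ (n : ℕ) :
    legendrePoly (n + 1) = legendrePoly n * Polynomial.X +
      (n : Polynomial ℂ) * Polynomial.derivative^[n - 1] (rodriguesPoly n) := by
  rw [legendrePoly, Function.iterate_succ_apply, derivative_rodriguesPoly_succ,
    Polynomial.iterate_derivative_mul_X, nsmul_eq_mul, legendrePoly]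

lemma derivative_legendrePoly (n : ℕ) :
    (Polynomial.X ^ 2 - 1) * Polynomial.derivative (legendrePoly n) =
      ((n : Polynomial ℂ) + 1) * (legendrePoly (n + 1) - Polynomial.X * legendrePoly n) := by
  have h := congrArg (Polynomial.derivative^[n + 1]) (rodriguesPoly_mul n)
  rw [Polynomial.iterate_derivative_sub, Polynomial.iterate_derivative_C_mul,
    Polynomial.iterate_derivative_mul_X, Polynomial.iterate_derivative_mul_X,
    add_tsub_cancel_right, Polynomial.iterate_derivative_mul_X, ← legendrePoly] at h
  have h₁ : Polynomial.derivative^[n + 1] (rodriguesPoly n) =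
      Polynomial.derivative (legendrePoly n) := by
    rw [Function.iterate_succ_apply', legendrePoly]
  have h₂ := legendrePoly_succ n
  rw [h₁, ← legendrePoly] at h
  simp only [nsmul_eq_mul, map_mul, map_add, map_ofNat, map_natCast, map_one] at h
  push_cast at h
  linear_combination h + ((n : Polynomial ℂ) + 1) * h₂

lemma derivative_legendrePoly_succ (n : ℕ) :
    (1 - Polynomial.X ^ 2) * Polynomial.derivative (legendrePoly (n + 1)) =
      ((n : Polynomial ℂ) + 1) * (legendrePoly n - Polynomial.X * legendrePoly (n + 1)) := by
  have hA : Polynomial.derivative (legendrePoly (n + 1)) =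
      Polynomial.X * Polynomial.derivative (legendrePoly n) +
        ((n : Polynomial ℂ) + 1) * legendrePoly n := by
    rcases n with _ | n
    · rw [legendrePoly_succ]
      simp [Polynomial.derivative_mul]
      ring
    · rw [legendrePoly_succ]
      have h : Polynomial.derivative (Polynomial.derivative^[n + 1 - 1] (rodriguesPoly (n + 1))) =
          legendrePoly (n + 1) := by
        rw [add_tsub_cancel_right, ← Function.iterate_succ_apply' Polynomial.derivative,
          legendrePoly]
      rw [Polynomial.derivative_add, Polynomial.derivative_mul, Polynomial.derivative_mul, h,
        Polynomial.derivative_natCast, Polynomial.derivative_X]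
      ring
  linear_combination (1 - Polynomial.X ^ 2) * hA - Polynomial.X * derivative_legendrePoly n

lemma legP_zero (z : ℂ) : legP 0 z = 1 := by simp [legP]

lemma legP_one (z : ℂ) : legP 1 z = z := by
  rw [legP_eq_eval, legendrePoly_succ, Polynomial.eval_add, Polynomial.eval_mul, ← legP_eq_eval,
    legP_zero]
  simp

lemma legP_add_two (n : ℕ) (z : ℂ) :
    ((n : ℂ) + 2) * legP (n + 2) z =
      (2 * n + 3) * z * legP (n + 1) z - (n + 1) * legP n z := by
  have h := congrArg (Polynomial.eval z) (derivative_legendrePoly (n + 1))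
  have h' := congrArg (Polynomial.eval z) (derivative_legendrePoly_succ n)
  simp only [legP_eq_eval]
  simp only [Polynomial.eval_mul, Polynomial.eval_sub, Polynomial.eval_add, Polynomial.eval_pow,
    Polynomial.eval_X, Polynomial.eval_one, Polynomial.eval_natCast] at h h'
  push_cast at h
  linear_combination -h - h'

/-- The polynomial part of `legQ`. -/
noncomputable def legW (l : ℕ) (z : ℂ) : ℂ :=
  ∑ j ∈ Finset.Icc 1 l, legP (j - 1) z * legP (l - j) z / (j : ℂ)

section GeneratingFunction

open PowerSeries

/-- The generating function of the Legendre polynomials. -/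
noncomputable def legGen (z : ℂ) : PowerSeries ℂ := PowerSeries.mk fun n => legP n z

/-- The formal primitive of `legGen`. -/
noncomputable def legGenPrim (z : ℂ) : PowerSeries ℂ :=
  PowerSeries.mk fun n => legP (n - 1) z / (n : ℂ)

lemma derivative_legGenPrim (z : ℂ) : d⁄dX ℂ (legGenPrim z) = legGen z := by
  ext n
  have : (n : ℂ) + 1 ≠ 0 := by exact_mod_cast n.succ_ne_zero
  rw [coeff_derivative, legGenPrim, legGen, coeff_mk, coeff_mk, add_tsub_cancel_right]
  push_cast
  field_simp

lemma legGen_ode (z : ℂ) :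
    (1 - C (2 * z) * X + X * X) * d⁄dX ℂ (legGen z) = (C z - X) * legGen z := by
  have e : (1 - C (2 * z) * X + X * X) * d⁄dX ℂ (legGen z) =
      d⁄dX ℂ (legGen z) - C (2 * z) * (X * d⁄dX ℂ (legGen z)) + X * (X * d⁄dX ℂ (legGen z)) := by
    ring
  rw [e, sub_mul]
  ext n
  rcases n with _ | _ | n
  · simp only [map_add, map_sub, coeff_C_mul, coeff_zero_X_mul, coeff_derivative, legGen, coeff_mk]
    simp [legP_zero, legP_one]
  · have h := legP_add_two 0 z
    simp only [map_add, map_sub, coeff_C_mul, coeff_succ_X_mul, coeff_zero_X_mul,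
      coeff_derivative, legGen, coeff_mk]
    simp only [Nat.cast_zero, zero_add, legP_zero, legP_one] at h ⊢
    push_cast
    linear_combination h
  · have h := legP_add_two (n + 1) z
    simp only [map_add, map_sub, coeff_C_mul, coeff_succ_X_mul,
      coeff_derivative, legGen, coeff_mk]
    push_cast at h ⊢
    linear_combination h

lemma legGen_sq (z : ℂ) : (1 - C (2 * z) * X + X * X) * legGen z ^ 2 = 1 := by
  apply PowerSeries.derivative.ext
  · have h := legGen_ode z
    have hC : (C (2 * z) : PowerSeries ℂ) = 2 * C z := by rw [map_mul, map_ofNat]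
    rw [Derivation.leibniz, Derivation.leibniz_pow]
    simp only [map_add, map_sub, Derivation.leibniz, derivative_C, derivative_X, derivative_one,
      smul_eq_mul, nsmul_eq_mul, pow_one, Nat.cast_ofNat, Nat.add_one_sub_one]
    rw [hC] at h ⊢
    linear_combination 2 * legGen z * h
  · have h : constantCoeff (legGen z) = 1 := by
      rw [← coeff_zero_eq_constantCoeff_apply, legGen, coeff_mk, legP_zero]
    simp [h]

lemma coeff_legGenPrim_mul_legGen (n : ℕ) (z : ℂ) :
    coeff n (legGenPrim z * legGen z) = legW n z := by
  rw [coeff_mul]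
  simp only [legGenPrim, legGen, coeff_mk]
  rw [Finset.Nat.sum_antidiagonal_eq_sum_range_succ
    (fun i j => legP (i - 1) z / (i : ℂ) * legP j z), legW, Finset.range_eq_Ico,
    Finset.sum_eq_sum_Ico_succ_bot n.succ_pos]
  simp only [Nat.cast_zero, div_zero, zero_mul, zero_add]
  exact Finset.sum_congr (by ext; simp) fun j _ => by ring

lemma legW_add_two (n : ℕ) (z : ℂ) :
    ((n : ℂ) + 2) * legW (n + 2) z =
      (2 * n + 3) * z * legW (n + 1) z - (n + 1) * legW n z := by
  set w := legGenPrim z * legGen z with hw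
  have e : d⁄dX ℂ w - C (2 * z) * (X * d⁄dX ℂ w) + X * (X * d⁄dX ℂ w) = 1 + (C z * w - X * w) := by
    rw [hw, Derivation.leibniz, derivative_legGenPrim, smul_eq_mul, smul_eq_mul]
    linear_combination legGenPrim z * legGen_ode z + legGen_sq z
  have h := congrArg (coeff (n + 1)) e
  rcases n with _ | n
  · simp only [map_add, map_sub, coeff_C_mul, coeff_succ_X_mul, coeff_zero_X_mul,
      coeff_derivative, coeff_one, hw, coeff_legGenPrim_mul_legGen] at h
    simp at h ⊢
    linear_combination h
  · simp only [map_add, map_sub, coeff_C_mul, coeff_succ_X_mul,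
      coeff_derivative, coeff_one, hw, coeff_legGenPrim_mul_legGen] at h
    simp at h ⊢
    linear_combination h

end GeneratingFunction

section ImaginaryAxis

lemma hasDerivAt_ofReal (x : ℝ) : HasDerivAt (fun t : ℝ => (t : ℂ)) 1 x := by
  simpa using (hasDerivAt_id x).ofReal_comp

lemma one_add_I_mul_div_mem_slitPlane (x : ℝ) :
    (1 + Complex.I * x) / (1 - Complex.I * x) ∈ Complex.slitPlane := by
  have h : (1 + Complex.I * x) / (1 - Complex.I * x) =
      (((1 - x ^ 2) / (1 + x ^ 2) : ℝ) : ℂ) + ((2 * x / (1 + x ^ 2) : ℝ) : ℂ) * Complex.I := by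
    have h₁ : (1 : ℂ) + (x : ℂ) ^ 2 ≠ 0 := by
      exact_mod_cast (by positivity : (1 : ℝ) + x ^ 2 ≠ 0)
    have h₂ : (1 - Complex.I * x : ℂ) ≠ 0 := fun h => by
      have := congrArg Complex.re h
      simp at this
    push_cast
    field_simp
    linear_combination 2 * (x : ℂ) ^ 2 * Complex.I_sq
  rw [h, Complex.mem_slitPlane_iff]
  rcases eq_or_ne x 0 with rfl | hx
  · left
    simp
  · right
    have : (0 : ℝ) < 1 + x ^ 2 := by positivity
    rw [Complex.add_im, Complex.ofReal_im, Complex.im_ofReal_mul, Complex.I_im, zero_add, mul_one]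
    exact div_ne_zero (mul_ne_zero two_ne_zero hx) this.ne'

lemma hasDerivAt_half_log (x : ℝ) :
    HasDerivAt (fun t : ℝ => (1 / 2) * Complex.log ((1 + Complex.I * t) / (1 - Complex.I * t)))
      (Complex.I / (1 + (x : ℂ) ^ 2)) x := by
  have h₁ : (1 : ℂ) + (x : ℂ) ^ 2 ≠ 0 := by
    exact_mod_cast (by positivity : (1 : ℝ) + x ^ 2 ≠ 0)
  have h₂ : (1 - Complex.I * x : ℂ) ≠ 0 := fun h => by
    have := congrArg Complex.re h
    simp at this
  have h₃ : (1 + Complex.I * x : ℂ) ≠ 0 := fun h => by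
    have := congrArg Complex.re h
    simp at this
  have hI : HasDerivAt (fun t : ℝ => Complex.I * (t : ℂ)) Complex.I x := by
    simpa using (hasDerivAt_ofReal x).const_mul Complex.I
  have h := (((hI.const_add 1).div (hI.const_sub 1) h₂).clog_real
    (one_add_I_mul_div_mem_slitPlane x)).const_mul (1 / 2 : ℂ)
  refine h.congr_deriv ?_
  simp only [Pi.div_apply]
  field_simp
  linear_combination 2 * (x : ℂ) ^ 2 * Complex.I_sq

lemma legQ_eq (l : ℕ) (z : ℂ) :
    legQ l z = (1 / 2) * legP l z * Complex.log ((1 + z) / (1 - z)) - legW l z := rfl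

lemma legQ_zero (z : ℂ) : legQ 0 z = (1 / 2) * Complex.log ((1 + z) / (1 - z)) := by
  simp [legQ, legP_zero]

lemma legQ_one (z : ℂ) : legQ 1 z = z * ((1 / 2) * Complex.log ((1 + z) / (1 - z))) - 1 := by
  simp [legQ, legP_zero, legP_one]
  ring

lemma legQ_add_two (n : ℕ) (z : ℂ) :
    legQ (n + 2) z =
      ((2 * n + 3) * (z * legQ (n + 1) z) - (n + 1) * legQ n z) / ((n : ℂ) + 2) := by
  have h : (n : ℂ) + 2 ≠ 0 := by exact_mod_cast (n + 1).succ_ne_zero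
  rw [eq_div_iff h]
  simp only [legQ_eq]
  linear_combination (1 / 2 * Complex.log ((1 + z) / (1 - z))) * legP_add_two n z - legW_add_two n z

lemma hasDerivAt_legQ_aux (n : ℕ) (x : ℝ) :
    HasDerivAt (fun t : ℝ => legQ n (Complex.I * t))
        (Complex.I * (n + 1) * (Complex.I * x * legQ n (Complex.I * x) -
          legQ (n + 1) (Complex.I * x)) / (1 + (x : ℂ) ^ 2)) x ∧
      HasDerivAt (fun t : ℝ => legQ (n + 1) (Complex.I * t))
        ((n + 1) * (Complex.I * legQ n (Complex.I * x) + x * legQ (n + 1) (Complex.I * x)) /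
          (1 + (x : ℂ) ^ 2)) x := by
  have h₁ : (1 : ℂ) + (x : ℂ) ^ 2 ≠ 0 := by
    exact_mod_cast (by positivity : (1 : ℝ) + x ^ 2 ≠ 0)
  have hI : HasDerivAt (fun t : ℝ => Complex.I * (t : ℂ)) Complex.I x := by
    simpa using (hasDerivAt_ofReal x).const_mul Complex.I
  induction n with
  | zero =>
    have hL := hasDerivAt_half_log x
    simp only [zero_add, legQ_zero, legQ_one]
    refine ⟨hL.congr_deriv ?_, ((hI.mul hL).sub_const 1).congr_deriv ?_⟩
    · simp
    · simp only [Nat.cast_zero]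
      field_simp
      linear_combination 2 * (x : ℂ) * Complex.I_sq
  | succ n ih =>
    have h₂ : (n : ℂ) + 2 ≠ 0 := by exact_mod_cast (n + 1).succ_ne_zero
    obtain ⟨hb, ha⟩ := ih
    simp only [show n + 1 + 1 = n + 2 from rfl, legQ_add_two]
    refine ⟨ha.congr_deriv ?_, ((((hI.mul ha).const_mul (2 * (n : ℂ) + 3)).sub
      (hb.const_mul ((n : ℂ) + 1))).div_const ((n : ℂ) + 2)).congr_deriv ?_⟩
    · push_cast
      field_simp
      ring_nf
      simp only [Complex.I_sq]
      ring
    · push_cast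
      field_simp
      ring_nf
      simp only [Complex.I_sq]
      ring

lemma hasDerivAt_legQ (n : ℕ) (x : ℝ) :
    HasDerivAt (fun t : ℝ => legQ n (Complex.I * t))
      (Complex.I * (n + 1) * (Complex.I * x * legQ n (Complex.I * x) -
        legQ (n + 1) (Complex.I * x)) / (1 + (x : ℂ) ^ 2)) x :=
  (hasDerivAt_legQ_aux n x).1

lemma hasDerivAt_legQ_succ (n : ℕ) (x : ℝ) :
    HasDerivAt (fun t : ℝ => legQ (n + 1) (Complex.I * t))
      ((n + 1) * (Complex.I * legQ n (Complex.I * x) + x * legQ (n + 1) (Complex.I * x)) /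
        (1 + (x : ℂ) ^ 2)) x :=
  (hasDerivAt_legQ_aux n x).2

open scoped ContDiff in
lemma contDiff_legQ (n : ℕ) : ContDiff ℝ ∞ (fun t : ℝ => legQ n (Complex.I * t)) := by
  rw [contDiff_infty]
  intro m
  induction m generalizing n with
  | zero =>
    exact contDiff_zero.2 (continuous_iff_continuousAt.2 fun x => (hasDerivAt_legQ n x).continuousAt)
  | succ m ih =>
    push_cast
    rw [contDiff_succ_iff_deriv]
    refine ⟨fun x => (hasDerivAt_legQ n x).differentiableAt, by simp, ?_⟩
    rw [funext fun x => (hasDerivAt_legQ n x).deriv]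
    have hx : ContDiff ℝ m (fun t : ℝ => (t : ℂ)) := Complex.ofRealCLM.contDiff
    have hd : ContDiff ℝ m (fun t : ℝ => 1 + (t : ℂ) ^ 2) := contDiff_const.add (hx.pow 2)
    simp only [div_eq_mul_inv]
    refine (contDiff_const.mul (((contDiff_const.mul hx).mul (ih n)).sub (ih (n + 1)))).mul
      (hd.inv fun x => ?_)
    exact_mod_cast (by positivity : (1 : ℝ) + x ^ 2 ≠ 0)

lemma legQ_ode (n : ℕ) (x : ℝ) :
    (1 + (x : ℂ) ^ 2) * iteratedDeriv 2 (fun t : ℝ => legQ n (Complex.I * t)) x +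
      2 * x * iteratedDeriv 1 (fun t : ℝ => legQ n (Complex.I * t)) x -
        n * (n + 1) * legQ n (Complex.I * x) = 0 := by
  have h₁ : (1 : ℂ) + (x : ℂ) ^ 2 ≠ 0 := by
    exact_mod_cast (by positivity : (1 : ℝ) + x ^ 2 ≠ 0)
  have hx := hasDerivAt_ofReal x
  have h := (((((hx.const_mul Complex.I).mul (hasDerivAt_legQ n x)).sub
    (hasDerivAt_legQ_succ n x)).const_mul (Complex.I * ((n : ℂ) + 1))).div
      ((hx.pow 2).const_add 1) h₁).deriv
  rw [iteratedDeriv_succ, iteratedDeriv_one, funext fun x => (hasDerivAt_legQ n x).deriv]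
  refine (congrArg (fun d => (1 + (x : ℂ) ^ 2) * d + _ - _) h).trans ?_
  simp only [Pi.mul_apply, Pi.sub_apply, Pi.pow_apply]
  field_simp
  ring_nf
  simp only [Complex.I_sq, Complex.I_pow_three, Complex.I_pow_four]
  ring

end ImaginaryAxis

section AssociatedEquation

open scoped ContDiff

variable {f : ℝ → ℂ} {l : ℕ}

lemma iteratedDeriv_ode (hf : ContDiff ℝ ∞ f)
    (hode : ∀ x : ℝ, (1 + (x : ℂ) ^ 2) * iteratedDeriv 2 f x + 2 * x * iteratedDeriv 1 f x -
      l * (l + 1) * f x = 0) (n : ℕ) (x : ℝ) :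
    (1 + (x : ℂ) ^ 2) * iteratedDeriv (n + 2) f x + 2 * (n + 1) * x * iteratedDeriv (n + 1) f x +
      (n * (n + 1) - l * (l + 1)) * iteratedDeriv n f x = 0 := by
  induction n generalizing x with
  | zero =>
    have := hode x
    simp only [zero_add, iteratedDeriv_zero]
    push_cast
    linear_combination this
  | succ n ih =>
    have hd : ∀ m, HasDerivAt (iteratedDeriv m f) (iteratedDeriv (m + 1) f x) x := fun m => by
      rw [iteratedDeriv_succ]
      exact (hf.differentiable_iteratedDeriv m (by exact_mod_cast WithTop.coe_lt_top _) x).hasDerivAt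
    have hx := hasDerivAt_ofReal x
    have h := (((((hx.pow 2).const_add 1).mul (hd (n + 2))).add
      ((hx.const_mul (2 * ((n : ℂ) + 1))).mul (hd (n + 1)))).add
        ((hd n).const_mul ((n : ℂ) * (n + 1) - l * (l + 1)))).unique
          ((hasDerivAt_const x (0 : ℂ)).congr_of_eventuallyEq (Eventually.of_forall ih))
    simp only [Pi.pow_apply] at h
    push_cast
    linear_combination h

end AssociatedEquation

section Decay

open scoped ContDiff

variable {f : ℝ → ℂ} {l : ℕ}

lemma norm_one_add_ofReal_sq (x : ℝ) : ‖(1 : ℂ) + (x : ℂ) ^ 2‖ = √(1 + x ^ 2) ^ 2 := by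
  have h : (0 : ℝ) ≤ 1 + x ^ 2 := by positivity
  rw [Real.sq_sqrt h, ← Complex.norm_of_nonneg h]
  push_cast
  rfl

lemma abs_le_sqrt_one_add_sq (x : ℝ) : |x| ≤ √(1 + x ^ 2) :=
  Real.abs_le_sqrt (by linarith)

lemma one_le_sqrt_one_add_sq (x : ℝ) : 1 ≤ √(1 + x ^ 2) :=
  Real.one_le_sqrt.2 (by nlinarith [sq_nonneg x])

lemma hasDerivAt_iteratedDeriv (hf : ContDiff ℝ ∞ f) (m : ℕ) (x : ℝ) :
    HasDerivAt (iteratedDeriv m f) (iteratedDeriv (m + 1) f x) x := by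
  rw [iteratedDeriv_succ]
  exact (hf.differentiable_iteratedDeriv m (by exact_mod_cast WithTop.coe_lt_top _) x).hasDerivAt

lemma hasDerivAt_pow_mul_iteratedDeriv (hf : ContDiff ℝ ∞ f)
    (hode : ∀ x : ℝ, (1 + (x : ℂ) ^ 2) * iteratedDeriv 2 f x + 2 * x * iteratedDeriv 1 f x -
      l * (l + 1) * f x = 0) (n : ℕ) (x : ℝ) :
    HasDerivAt (fun t : ℝ => (1 + (t : ℂ) ^ 2) ^ (n + 1) * iteratedDeriv (n + 1) f t)
      (-((n * (n + 1) - l * (l + 1)) * ((1 + (x : ℂ) ^ 2) ^ n * iteratedDeriv n f x))) x := by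
  have h := ((((hasDerivAt_ofReal x).pow 2).const_add 1).pow (n + 1)).mul
    (hasDerivAt_iteratedDeriv hf (n + 1) x)
  refine h.congr_deriv ?_
  simp only [Pi.pow_apply]
  push_cast
  linear_combination (1 + (x : ℂ) ^ 2) ^ n * iteratedDeriv_ode hf hode n x

lemma exists_norm_iteratedDeriv_mul_le (hf : ContDiff ℝ ∞ f)
    (hode : ∀ x : ℝ, (1 + (x : ℂ) ^ 2) * iteratedDeriv 2 f x + 2 * x * iteratedDeriv 1 f x -
      l * (l + 1) * f x = 0) {n : ℕ} (hn : l + 1 ≤ n) :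
    ∃ C : ℝ, ∀ x : ℝ, ‖iteratedDeriv n f x‖ * √(1 + x ^ 2) ^ (n + l + 1) ≤ C := by
  have step : ∀ m (x : ℝ), √(1 + x ^ 2) ^ 2 * ‖iteratedDeriv (m + 2) f x‖ ≤
      2 * (m + 1) * √(1 + x ^ 2) * ‖iteratedDeriv (m + 1) f x‖ +
        ‖(m * (m + 1) - l * (l + 1) : ℂ)‖ * ‖iteratedDeriv m f x‖ := fun m x => by
    have h : (1 + (x : ℂ) ^ 2) * iteratedDeriv (m + 2) f x =
        -((2 * ((m + 1 : ℕ) : ℂ) * x * iteratedDeriv (m + 1) f x) +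
          (m * (m + 1) - l * (l + 1)) * iteratedDeriv m f x) := by
      push_cast
      linear_combination iteratedDeriv_ode hf hode m x
    rw [← norm_one_add_ofReal_sq, ← norm_mul, h, norm_neg]
    refine (norm_add_le _ _).trans ?_
    rw [norm_mul, norm_mul, norm_mul, norm_mul, Complex.norm_natCast, Complex.norm_real,
      Complex.norm_ofNat, Real.norm_eq_abs]
    push_cast
    gcongr
    exact abs_le_sqrt_one_add_sq x
  have key : ∀ m, (∃ C : ℝ, ∀ x : ℝ,
        ‖iteratedDeriv (l + 1 + m) f x‖ * √(1 + x ^ 2) ^ (l + 1 + m + l + 1) ≤ C) ∧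
      ∃ C : ℝ, ∀ x : ℝ,
        ‖iteratedDeriv (l + 1 + m + 1) f x‖ * √(1 + x ^ 2) ^ (l + 1 + m + 1 + l + 1) ≤ C := by
    intro m
    induction m with
    | zero =>
      have hbase : ∃ C : ℝ, ∀ x : ℝ,
          ‖iteratedDeriv (l + 1) f x‖ * √(1 + x ^ 2) ^ (l + 1 + l + 1) ≤ C := by
        have hd : ∀ x, HasDerivAt
            (fun t : ℝ => (1 + (t : ℂ) ^ 2) ^ (l + 1) * iteratedDeriv (l + 1) f t) 0 x := fun x =>
          (hasDerivAt_pow_mul_iteratedDeriv hf hode l x).congr_deriv (by ring)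
        refine ⟨‖(1 + ((0 : ℝ) : ℂ) ^ 2) ^ (l + 1) * iteratedDeriv (l + 1) f 0‖, fun x => ?_⟩
        rw [is_const_of_deriv_eq_zero (fun x => (hd x).differentiableAt) (fun x => (hd x).deriv) 0 x,
          norm_mul, norm_pow, norm_one_add_ofReal_sq]
        exact le_of_eq (by ring)
      refine ⟨hbase, ?_⟩
      obtain ⟨C, hC⟩ := hbase
      refine ⟨2 * (l + 1) * C, fun x => ?_⟩
      have h := step l x
      rw [sub_self, norm_zero, zero_mul, add_zero] at h
      calc _ = √(1 + x ^ 2) ^ 2 * ‖iteratedDeriv (l + 2) f x‖ * √(1 + x ^ 2) ^ (l + l + 1) := by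
            ring
        _ ≤ 2 * (l + 1) * √(1 + x ^ 2) * ‖iteratedDeriv (l + 1) f x‖ *
            √(1 + x ^ 2) ^ (l + l + 1) := by gcongr
        _ = 2 * (l + 1) * (‖iteratedDeriv (l + 1) f x‖ * √(1 + x ^ 2) ^ (l + 1 + l + 1)) := by ring
        _ ≤ _ := by gcongr; exact hC x
    | succ m ih =>
      refine ⟨ih.2, ?_⟩
      obtain ⟨⟨C, hC⟩, D, hD⟩ := ih
      rw [← add_assoc (l + 1) m 1]
      generalize l + 1 + m = n at hC hD
      refine ⟨2 * (n + 1) * D + ‖(n * (n + 1) - l * (l + 1) : ℂ)‖ * C, fun x => ?_⟩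
      calc _ = √(1 + x ^ 2) ^ 2 * ‖iteratedDeriv (n + 2) f x‖ * √(1 + x ^ 2) ^ (n + l + 1) := by
            ring
        _ ≤ (2 * (n + 1) * √(1 + x ^ 2) * ‖iteratedDeriv (n + 1) f x‖ +
            ‖(n * (n + 1) - l * (l + 1) : ℂ)‖ * ‖iteratedDeriv n f x‖) *
              √(1 + x ^ 2) ^ (n + l + 1) := by gcongr; exact step n x
        _ = 2 * (n + 1) * (‖iteratedDeriv (n + 1) f x‖ * √(1 + x ^ 2) ^ (n + 1 + l + 1)) +
            ‖(n * (n + 1) - l * (l + 1) : ℂ)‖ *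
              (‖iteratedDeriv n f x‖ * √(1 + x ^ 2) ^ (n + l + 1)) := by ring
        _ ≤ _ := by gcongr; exacts [hD x, hC x]
  obtain ⟨m, rfl⟩ := Nat.exists_eq_add_of_le hn
  exact (key m).1

lemma integrable_pow_mul_iteratedDeriv_sq (hf : ContDiff ℝ ∞ f)
    (hode : ∀ x : ℝ, (1 + (x : ℂ) ^ 2) * iteratedDeriv 2 f x + 2 * x * iteratedDeriv 1 f x -
      l * (l + 1) * f x = 0) {n : ℕ} (hn : l + 1 ≤ n) :
    Integrable fun x : ℝ => (1 + (x : ℂ) ^ 2) ^ n * iteratedDeriv n f x ^ 2 := by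
  obtain ⟨C, hC⟩ := exists_norm_iteratedDeriv_mul_le hf hode hn
  have hcont : Continuous (iteratedDeriv n f) :=
    continuous_iff_continuousAt.2 fun x => (hasDerivAt_iteratedDeriv hf n x).continuousAt
  refine (integrable_inv_one_add_sq.const_mul (C ^ 2)).mono' (by fun_prop)
    (Eventually.of_forall fun x => ?_)
  have hs := one_le_sqrt_one_add_sq x
  have h0 : (0 : ℝ) ≤ 1 + x ^ 2 := by positivity
  rw [← Real.sq_sqrt h0, ← div_eq_mul_inv, le_div_iff₀ (by positivity), norm_mul, norm_pow,
    norm_pow, norm_one_add_ofReal_sq]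
  calc _ = ‖iteratedDeriv n f x‖ ^ 2 * √(1 + x ^ 2) ^ (2 * n + 2) := by ring
    _ ≤ ‖iteratedDeriv n f x‖ ^ 2 * √(1 + x ^ 2) ^ (2 * (n + l + 1)) := by
      exact mul_le_mul_of_nonneg_left (pow_le_pow_right₀ hs (by omega)) (by positivity)
    _ = (‖iteratedDeriv n f x‖ * √(1 + x ^ 2) ^ (n + l + 1)) ^ 2 := by ring
    _ ≤ C ^ 2 := by gcongr; exact hC x

lemma tendsto_pow_mul_iteratedDeriv_mul (hf : ContDiff ℝ ∞ f)
    (hode : ∀ x : ℝ, (1 + (x : ℂ) ^ 2) * iteratedDeriv 2 f x + 2 * x * iteratedDeriv 1 f x -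
      l * (l + 1) * f x = 0) {n : ℕ} (hn : l + 1 ≤ n) {F : Filter ℝ}
    (hF : Tendsto (fun x : ℝ => |x|) F atTop) :
    Tendsto (fun x : ℝ => (1 + (x : ℂ) ^ 2) ^ (n + 1) * iteratedDeriv (n + 1) f x *
      iteratedDeriv n f x) F (nhds 0) := by
  obtain ⟨C, hC⟩ := exists_norm_iteratedDeriv_mul_le hf hode hn
  obtain ⟨D, hD⟩ := exists_norm_iteratedDeriv_mul_le hf hode (n := n + 1) (by omega)
  have hlim : Tendsto (fun x : ℝ => D * C * (√(1 + x ^ 2))⁻¹) F (nhds 0) := by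
    simpa using (tendsto_inv_atTop_zero.comp
      (tendsto_atTop_mono abs_le_sqrt_one_add_sq hF)).const_mul (D * C)
  refine squeeze_zero_norm (fun x => ?_) hlim
  have hs := one_le_sqrt_one_add_sq x
  have hD0 : 0 ≤ D := le_trans (by positivity) (hD x)
  rw [← div_eq_mul_inv, le_div_iff₀ (by positivity), norm_mul, norm_mul, norm_pow,
    norm_one_add_ofReal_sq]
  calc _ = ‖iteratedDeriv (n + 1) f x‖ * ‖iteratedDeriv n f x‖ * √(1 + x ^ 2) ^ (2 * n + 3) := by
        ring
    _ ≤ ‖iteratedDeriv (n + 1) f x‖ * ‖iteratedDeriv n f x‖ *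
        √(1 + x ^ 2) ^ (n + 1 + l + 1 + (n + l + 1)) := by
      exact mul_le_mul_of_nonneg_left (pow_le_pow_right₀ hs (by omega)) (by positivity)
    _ = ‖iteratedDeriv (n + 1) f x‖ * √(1 + x ^ 2) ^ (n + 1 + l + 1) *
        (‖iteratedDeriv n f x‖ * √(1 + x ^ 2) ^ (n + l + 1)) := by ring
    _ ≤ D * C := by gcongr; exacts [hD x, hC x]

lemma integral_pow_mul_iteratedDeriv_sq (hf : ContDiff ℝ ∞ f)
    (hode : ∀ x : ℝ, (1 + (x : ℂ) ^ 2) * iteratedDeriv 2 f x + 2 * x * iteratedDeriv 1 f x -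
      l * (l + 1) * f x = 0) {n : ℕ} (hn : l + 1 ≤ n) :
    ∫ x : ℝ, (1 + (x : ℂ) ^ 2) ^ (n + 1) * iteratedDeriv (n + 1) f x ^ 2 =
      ((n : ℂ) * (n + 1) - l * (l + 1)) *
        ∫ x : ℝ, (1 + (x : ℂ) ^ 2) ^ n * iteratedDeriv n f x ^ 2 := by
  have h := integral_mul_deriv_eq_deriv_mul
    (fun x _ => hasDerivAt_pow_mul_iteratedDeriv hf hode n x)
    (fun x _ => hasDerivAt_iteratedDeriv hf n x)
    ((integrable_pow_mul_iteratedDeriv_sq hf hode (n := n + 1) (by omega)).congr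
      (Eventually.of_forall fun x => by simp only [Pi.mul_apply]; ring))
    (((integrable_pow_mul_iteratedDeriv_sq hf hode hn).const_mul
      (-((n : ℂ) * (n + 1) - l * (l + 1)))).congr
        (Eventually.of_forall fun x => by simp only [Pi.mul_apply]; ring))
    (tendsto_pow_mul_iteratedDeriv_mul hf hode hn tendsto_abs_atBot_atTop)
    (tendsto_pow_mul_iteratedDeriv_mul hf hode hn tendsto_abs_atTop_atTop)
  rw [sub_self, zero_sub, ← integral_neg] at h
  rw [← integral_const_mul]
  refine (integral_congr_ae (Eventually.of_forall fun x => ?_)).trans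
    (h.trans (integral_congr_ae (Eventually.of_forall fun x => ?_))) <;> ring

end Decay

lemma Qi_sq (k l : ℕ) (x : ℝ) :
    Qi k l x ^ 2 = (-1) ^ k * ((1 + (x : ℂ) ^ 2) ^ k *
      iteratedDeriv k (fun t : ℝ => legQ l (Complex.I * t)) x ^ 2) := by
  have h₁ : ((((1 + x ^ 2) ^ ((k : ℝ) / 2) : ℝ) : ℂ)) ^ 2 = (1 + (x : ℂ) ^ 2) ^ k := by
    have h : ((1 + x ^ 2) ^ ((k : ℝ) / 2)) ^ 2 = (1 + x ^ 2) ^ k := by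
      rw [← Real.rpow_natCast, ← Real.rpow_mul (by positivity), ← Real.rpow_natCast]
      norm_num
    exact_mod_cast congrArg Complex.ofReal h
  have h₂ : (Complex.I ^ (-(k : ℤ))) ^ 2 = (-1) ^ k := by
    rw [zpow_neg, zpow_natCast, inv_pow, ← pow_mul, mul_comm, pow_mul, Complex.I_sq, ← inv_pow]
    norm_num
  have h₃ : (((-1 : ℂ) ^ k)) ^ 2 = 1 := by rw [← pow_mul, mul_comm, pow_mul]; norm_num
  rw [Qi, mul_pow, mul_pow, mul_pow, h₁, h₂, h₃]
  ring

/-- Recursion in the order `k` for the normalization integrals, `k ≥ ℓ+2`. -/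
theorem legendreQ_imag_norm_rec (k l : ℕ) (hk : l + 2 ≤ k) :
    ∫ x : ℝ, (Qi k l x) ^ 2 =
      ((((l : ℤ) + (k : ℤ)) * ((l : ℤ) - (k : ℤ) + 1) : ℤ) : ℂ) *
        ∫ x : ℝ, (Qi (k - 1) l x) ^ 2 := by
  obtain ⟨n, rfl⟩ : ∃ n, k = n + 1 := ⟨k - 1, by omega⟩
  simp only [Qi_sq, add_tsub_cancel_right, integral_const_mul]
  rw [integral_pow_mul_iteratedDeriv_sq (contDiff_legQ l) (legQ_ode l) (by omega : l + 1 ≤ n)]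
  push_cast
  ring
end

section
/- For every natural number ℓ, Σ_{n=0}^{⌊ℓ/2⌋} (−1)^n·(2ℓ−2n)!·(2n)! / ((2n+1)!·(ℓ−2n)!·(ℓ−n)!·n!) = 4^ℓ/(ℓ+1), where the identity is between rational numbers and ⌊ℓ/2⌋ is the greatest integer not exceeding ℓ/2. -/
open Finset

theorem prod_erase_range_cast_sub (i m : ℕ) :
    ∏ j ∈ (range (i + m + 1)).erase i, ((i : ℚ) - j) =
      (-1) ^ m * (i.factorial : ℚ) * (m.factorial : ℚ) := by
  induction m with
  | zero =>
    rw [add_zero, range_add_one, erase_insert notMem_range_self,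
      ← descPochhammer_eval_eq_prod_range, descPochhammer_eval_eq_descFactorial,
      Nat.descFactorial_self]
    simp
  | succ m ih =>
    rw [← add_assoc, range_add_one (n := i + m + 1), erase_insert_of_ne (by lia),
      prod_insert (by simp), ih, Nat.factorial_succ]
    push_cast
    ring

/-- The barycentric form of Lagrange interpolation at the nodes `0, 1, …, l` uses the weights
`(-1) ^ (l - i) / (i! * (l - i)!)`. -/
theorem nodalWeight_range_cast {l i : ℕ} (hi : i ≤ l) :
    Lagrange.nodalWeight (range (l + 1)) (fun j : ℕ => (j : ℚ)) i =
      (-1) ^ (l - i) / ((i.factorial : ℚ) * ((l - i).factorial : ℚ)) := by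
  obtain ⟨m, rfl⟩ := Nat.exists_eq_add_of_le hi
  rw [Lagrange.nodalWeight, prod_inv_distrib, prod_erase_range_cast_sub, Nat.add_sub_cancel_left]
  rcases neg_one_pow_eq_or ℚ m with h | h <;> rw [h] <;> field_simp

theorem prod_range_neg_half_sub (l : ℕ) :
    ∏ j ∈ range (l + 1), (-(1 / 2) - (j : ℚ)) =
      (-1) ^ (l + 1) * ((2 * l + 1).factorial : ℚ) / (2 * 4 ^ l * (l.factorial : ℚ)) := by
  induction l with
  | zero => norm_num
  | succ l ih =>
    rw [prod_range_succ, ih, show 2 * (l + 1) + 1 = 2 * l + 1 + 1 + 1 by ring,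
      Nat.factorial_succ (2 * l + 1 + 1), Nat.factorial_succ (2 * l + 1), Nat.factorial_succ l]
    push_cast
    field_simp
    ring

open Polynomial in
theorem sum_range_descFactorial_div (l : ℕ) :
    ∑ n ∈ range (l + 1), (-1 : ℚ) ^ n * ((2 * l - 2 * n).descFactorial l : ℚ) /
        ((2 * n + 1) * ((n.factorial : ℚ) * ((l - n).factorial : ℚ))) =
      (4 : ℚ) ^ l / ((l : ℚ) + 1) := by
  set P : ℚ[X] := (descPochhammer ℚ l).comp (C (-2) * X + C (2 * (l : ℚ)))
  have hdeg : P.degree < #(range (l + 1)) := by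
    rw [card_range]
    refine degree_le_natDegree.trans_lt ?_
    rw [natDegree_comp, descPochhammer_natDegree, natDegree_linear (by norm_num), mul_one]
    exact_mod_cast l.lt_succ_self
  have hnode (n : ℕ) (hn : n ∈ range (l + 1)) :
      P.eval (n : ℚ) = ((2 * l - 2 * n).descFactorial l : ℚ) := by
    have hn : n ≤ l := by simpa [Nat.lt_succ_iff] using hn
    rw [← descPochhammer_eval_eq_descFactorial, Nat.cast_sub (by lia), eval_comp]
    congr 1
    simp
    ring
  have hhalf : P.eval (-(1 / 2)) = ((2 * l + 1).descFactorial l : ℚ) := by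
    rw [← descPochhammer_eval_eq_descFactorial, eval_comp]
    congr 1
    simp
    ring
  have hne (n : ℕ) (_ : n ∈ range (l + 1)) : (-(1 / 2) : ℚ) ≠ n := by
    have : (0 : ℚ) ≤ n := n.cast_nonneg
    linarith
  have key := congrArg (eval (-(1 / 2) : ℚ))
    (Lagrange.eq_interpolate_of_eval_eq _ (Nat.cast_injective.injOn) hdeg hnode)
  rw [hhalf, Lagrange.eval_interpolate_not_at_node _ hne, Lagrange.eval_nodal,
    prod_range_neg_half_sub] at key
  have hsum : ∑ n ∈ range (l + 1), Lagrange.nodalWeight (range (l + 1)) (fun j : ℕ => (j : ℚ)) n *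
        (-(1 / 2) - (n : ℚ))⁻¹ * ((2 * l - 2 * n).descFactorial l : ℚ) =
      2 * (-1) ^ (l + 1) * ∑ n ∈ range (l + 1),
        (-1 : ℚ) ^ n * ((2 * l - 2 * n).descFactorial l : ℚ) /
          ((2 * n + 1) * ((n.factorial : ℚ) * ((l - n).factorial : ℚ))) := by
    rw [mul_sum]
    refine sum_congr rfl fun n hn => ?_
    obtain ⟨m, rfl⟩ := Nat.exists_eq_add_of_le (Nat.lt_succ_iff.1 (mem_range.1 hn))
    rw [nodalWeight_range_cast (Nat.le_add_right n m), Nat.add_sub_cancel_left,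
      show (-(1 / 2) - (n : ℚ))⁻¹ = -2 / (2 * n + 1) by
        rw [show -(1 / 2) - (n : ℚ) = -(2 * n + 1) / 2 by ring, inv_div, div_neg, neg_div]]
    have hsq : ((-1 : ℚ) ^ n) * (-1) ^ n = 1 := by rw [← mul_pow]; norm_num
    rw [pow_succ, pow_add]
    field_simp
    linear_combination ((2 * (n + m) - 2 * n).descFactorial (n + m) : ℚ) * hsq
  rw [hsum] at key
  have hfac : (((l + 1).factorial : ℚ)) * ((2 * l + 1).descFactorial l : ℚ) =
      ((2 * l + 1).factorial : ℚ) := by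
    have := Nat.factorial_mul_descFactorial (n := 2 * l + 1) (k := l) (by lia)
    rw [show 2 * l + 1 - l = l + 1 by lia] at this
    exact_mod_cast this
  have hsq : ((-1 : ℚ) ^ (l + 1)) * (-1) ^ (l + 1) = 1 := by rw [← mul_pow]; norm_num
  have hpos : ((2 * l + 1).factorial : ℚ) ≠ 0 := by positivity
  generalize ∑ n ∈ range (l + 1), (-1 : ℚ) ^ n * ((2 * l - 2 * n).descFactorial l : ℚ) /
    ((2 * n + 1) * ((n.factorial : ℚ) * ((l - n).factorial : ℚ))) = S at key ⊢
  have key' : ((2 * l + 1).descFactorial l : ℚ) =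
      ((2 * l + 1).factorial : ℚ) * S / (4 ^ l * (l.factorial : ℚ)) := by
    rw [key]
    field_simp
    linear_combination S * hsq
  rw [key', Nat.factorial_succ] at hfac
  push_cast at hfac
  field_simp at hfac ⊢
  linear_combination hfac

/-- Saalschütz-type evaluation of the finite sum appearing in the computation
of `A₀(ℓ)`. -/
theorem saalschuetz_sum (l : ℕ) :
    ∑ n ∈ Finset.range (l / 2 + 1),
        ((-1 : ℚ) ^ n * ((2 * l - 2 * n).factorial : ℚ) * ((2 * n).factorial : ℚ)) /
          (((2 * n + 1).factorial : ℚ) * ((l - 2 * n).factorial : ℚ) *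
            ((l - n).factorial : ℚ) * (n.factorial : ℚ)) =
      (4 : ℚ) ^ l / ((l : ℚ) + 1) := by
  rw [← sum_range_descFactorial_div]
  refine sum_subset_zero_on_sdiff (range_mono (by lia)) (fun n hn => ?_) fun n hn => ?_
  · simp only [mem_sdiff, mem_range] at hn
    rw [Nat.descFactorial_eq_zero_iff_lt.2 (by lia)]
    simp
  · have hn : 2 * n ≤ l := by
      rw [mem_range] at hn
      lia
    have hfac := Nat.factorial_mul_descFactorial (n := 2 * l - 2 * n) (k := l) (by lia)
    rw [show 2 * l - 2 * n - l = l - 2 * n by lia] at hfac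
    rw [← hfac, Nat.factorial_succ (2 * n)]
    push_cast
    field_simp
end
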